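/- arXiv:1711.03923 — 3 statements merged into one kernel-verified Lean document; each statement's English description precedes it below -/
import Mathlib

section
/- For all m, n ≥ 1, k ≥ 0 and 1 ≤ s ≤ n+1, one has RPqt•(m,n;s;k) = RPqt★(n,m;s;k) in ℤ[q,t]; in particular, summing over all s, Σ_{P ∈ RP(m,n)^{•k}} q^{area(P)} t^{underlined-bounce(P)} = Σ_{Q ∈ RP(n,m)^{★k}} q^{dinv(Q)} t^{underlined-area(Q)}. -/
open Finset

/- ## Reduced parallelogram polyominoes

Letters of the ordered alphabet `0 < 0̄ < 1 < 1̄ < 2 < 2̄ < ⋯` are encoded as natural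
numbers: the letter with numeric value `v` is encoded as `2*v` if unbarred and as
`2*v+1` if barred.  With this encoding the order of the alphabet is the order of `ℕ`,
the successor in the alphabet is `+1`, the numeric value of a letter `c` is `c / 2`,
and a letter is barred iff `c % 2 = 1`. -/

/-- A reduced parallelogram polyomino of size `m × n`: a pair of `{0,1}`-sequences
(`true` = north step, `false` = east step) of length `m+n`, each with `n` north steps,
the red path staying weakly above the green one. -/
structure RedPoly (m n : ℕ) where
  red : Fin (m + n) → Bool
  green : Fin (m + n) → Bool
  red_count : (univ.filter fun i => red i = true).card = n
  green_count : (univ.filter fun i => green i = true).card = n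
  green_le_red : ∀ i : Fin (m + n),
    (univ.filter fun j => j ≤ i ∧ green j = true).card ≤
    (univ.filter fun j => j ≤ i ∧ red j = true).card

/-- Number of `true` entries strictly before position `j`. -/
def truesBefore {N : ℕ} (p : Fin N → Bool) (j : Fin N) : ℕ :=
  (univ.filter fun l => l < j ∧ p l = true).card

/-- Number of `false` entries strictly before position `j`. -/
def falsesBefore {N : ℕ} (p : Fin N → Bool) (j : Fin N) : ℕ :=
  (univ.filter fun l => l < j ∧ p l = false).card

/-- The height of the lattice path `p` over the column `[x, x+1]`, i.e. the number of
north steps occurring before the `(x+1)`-st east step. -/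
def heightAt {N : ℕ} (p : Fin N → Bool) (x : ℕ) : ℕ :=
  (univ.filter fun j => p j = true ∧ falsesBefore p j ≤ x).card

/-- The `x`-coordinate at which the lattice path `p` makes its north step from height
`y` to height `y+1`, i.e. the number of east steps occurring before the `(y+1)`-st
north step. -/
def xcoordAt {N : ℕ} (p : Fin N → Bool) (y : ℕ) : ℕ :=
  (univ.filter fun j => p j = false ∧ truesBefore p j ≤ y).card

/-- Reading a sequence of northeast (`true`) / southeast (`false`) steps starting at
height `h`, record for each northeast step the (encoded) letter of the level at which
it ends: a northeast step from height `h` to `h+1` ends at level `h+1`, whose letter is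
the `(h+1)`-st letter of the alphabet, encoded as `h`. -/
def areaWordAux : ℕ → List Bool → List ℕ
  | _, [] => []
  | h, true :: rest => h :: areaWordAux (h + 1) rest
  | h, false :: rest => areaWordAux (h - 1) rest

/-- The interlaced Dyck path `D = (1, r₁, 1-g₁, r₂, 1-g₂, …, r_{m+n}, 1-g_{m+n}, 0)`. -/
def interlaced {m n : ℕ} (P : RedPoly m n) : List Bool :=
  true :: ((List.ofFn fun i : Fin (m + n) => [P.red i, !P.green i]).flatten ++ [false])

/-- The area word of a reduced parallelogram polyomino (letters encoded in `ℕ`). -/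
def areaWord {m n : ℕ} (P : RedPoly m n) : List ℕ :=
  areaWordAux 0 (interlaced P)

/-- `area`: the sum of the numeric values of the letters of the area word. -/
def areaStat {m n : ℕ} (P : RedPoly m n) : ℕ :=
  ((areaWord P).map fun c => c / 2).sum

/-- `dinv`: the number of pairs of positions `i < j` in the area word such that the
letter in position `i` is the successor (in the alphabet) of the letter in position `j`. -/
def dinvStat {m n : ℕ} (P : RedPoly m n) : ℕ :=
  ((Finset.range (areaWord P).length ×ˢ Finset.range (areaWord P).length).filter
    fun p => p.1 < p.2 ∧ (areaWord P).getD p.1 0 = (areaWord P).getD p.2 0 + 1).card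

/-- `d` is the position of the unbarred letter of a rise of the word `w`: the letter at
position `d-1` is barred and the letter at position `d` is its successor in the
alphabet. -/
def IsRise (w : List ℕ) (d : ℕ) : Prop :=
  0 < d ∧ d < w.length ∧ w.getD (d - 1) 0 % 2 = 1 ∧ w.getD d 0 = w.getD (d - 1) 0 + 1

/-- An `m × n` reduced parallelogram polyomino with `k` decorated rises (the marks
record the positions of the unbarred letters of the marked rises in the area word). -/
structure RiseDecorated (m n k : ℕ) where
  poly : RedPoly m n
  marks : Finset ℕ
  marks_card : marks.card = k
  marks_rise : ∀ d ∈ marks, IsRise (areaWord poly) d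

/-- `underlined-area`: the sum of the numeric values of the letters of the area word,
the marked letters excepted. -/
def uArea {m n k : ℕ} (Q : RiseDecorated m n k) : ℕ :=
  ∑ i ∈ Finset.range (areaWord Q.poly).length \ Q.marks, (areaWord Q.poly).getD i 0 / 2

/-- The corner points of the bounce path: `bouncePt P k = (X k, Y k)` where the
`(k+1)`-st vertical run goes from height `Y k` up to `Y (k+1)` (the height at which the
red path makes its east step over the current column), and the `(k+1)`-st horizontal
run goes from `X k` to `X (k+1)` (the `x`-coordinate at which the green path makes its
north step from the current height). -/
def bouncePt {m n : ℕ} (P : RedPoly m n) : ℕ → ℕ × ℕ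
  | 0 => (0, 0)
  | k + 1 =>
    (xcoordAt P.green (heightAt P.red (bouncePt P k).1),
     heightAt P.red (bouncePt P k).1)

/-- The numeric value of the label of the vertical step of the bounce path in row `y`
(the vertical steps of the `(k+1)`-st vertical run carry the unbarred letter `k`). -/
def vertLabel {m n : ℕ} (P : RedPoly m n) (y : ℕ) : ℕ :=
  ((Finset.range (m + n)).filter fun k => (bouncePt P (k + 1)).2 ≤ y).card

/-- The numeric value of the label of the horizontal step of the bounce path in column
`x` (the horizontal steps of the `(k+1)`-st horizontal run carry the barred letter `k̄`). -/
def horLabel {m n : ℕ} (P : RedPoly m n) (x : ℕ) : ℕ :=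
  ((Finset.range (m + n)).filter fun k => (bouncePt P (k + 1)).1 ≤ x).card

/-- `bounce`: the sum of the numeric values of the labels of the bounce path. -/
def bounceStat {m n : ℕ} (P : RedPoly m n) : ℕ :=
  (∑ y ∈ Finset.range n, vertLabel P y) + ∑ x ∈ Finset.range m, horLabel P x

/-- The number of labels of the bounce path equal to the (unbarred) letter `0`. -/
def zeroLabelCount {m n : ℕ} (P : RedPoly m n) : ℕ :=
  ((Finset.range n).filter fun y => vertLabel P y = 0).card

/-- A red valley: a north step of the red path preceded by an east step. -/
def IsRedValley {m n : ℕ} (P : RedPoly m n) (j : Fin (m + n)) : Prop :=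
  P.red j = true ∧ ∃ i : Fin (m + n), (i : ℕ) + 1 = (j : ℕ) ∧ P.red i = false

/-- The row (counted from `0`) occupied by the north step `j` of the red path. -/
def rowOf {m n : ℕ} (P : RedPoly m n) (j : Fin (m + n)) : ℕ :=
  truesBefore P.red j

/-- An `m × n` reduced parallelogram polyomino with `k` decorated red valleys. -/
structure ValleyDecorated (m n k : ℕ) where
  poly : RedPoly m n
  marks : Finset (Fin (m + n))
  marks_card : marks.card = k
  marks_valley : ∀ j ∈ marks, IsRedValley poly j

/-- `underlined-bounce`: the sum of the numeric values of the labels of the bounce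
path, excluding the labels of the bounce-path steps lying in the same row as a marked
valley. -/
def uBounce {m n k : ℕ} (Q : ValleyDecorated m n k) : ℕ :=
  (∑ y ∈ Finset.range n \ Q.marks.image (rowOf Q.poly), vertLabel Q.poly y) +
    ∑ x ∈ Finset.range m, horLabel Q.poly x

/- ## q,t-enumerators -/

/-- `q`, as an element of `ℤ[q,t] = MvPolynomial (Fin 2) ℤ`. -/
noncomputable def Xq : MvPolynomial (Fin 2) ℤ := MvPolynomial.X 0

/-- `t`, as an element of `ℤ[q,t] = MvPolynomial (Fin 2) ℤ`. -/
noncomputable def Xt : MvPolynomial (Fin 2) ℤ := MvPolynomial.X 1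

/-- The Gaussian `q`-binomial coefficient `[a choose b]_x`, defined by the `q`-Pascal
recursion `[a+1 choose b+1] = [a choose b] + x^(b+1) * [a choose b+1]`. -/
def qbinom {R : Type*} [CommSemiring R] (x : R) : ℕ → ℕ → R
  | _, 0 => 1
  | 0, _ + 1 => 0
  | a + 1, b + 1 => qbinom x a b + x ^ (b + 1) * qbinom x a (b + 1)

/-- `RPqt•(m,n;s;k)`: the `(area, underlined-bounce)` `q,t`-enumerator of `m × n`
reduced polyominoes with `k` decorated red valleys whose bounce path carries exactly
`s-1` labels equal to the letter `0`. -/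
noncomputable def RPbullet (m n s k : ℕ) : MvPolynomial (Fin 2) ℤ :=
  ∑ᶠ Q : ValleyDecorated m n k,
    if zeroLabelCount Q.poly + 1 = s then Xq ^ areaStat Q.poly * Xt ^ uBounce Q else 0

/-- `RPqt★(a,b;s;k)`: the `(dinv, underlined-area)` `q,t`-enumerator of `a × b` reduced
polyominoes with `k` decorated rises whose area word contains exactly `s` letters equal
to the unbarred letter `0`. -/
noncomputable def RPstar (a b s k : ℕ) : MvPolynomial (Fin 2) ℤ :=
  ∑ᶠ Q : RiseDecorated a b k,
    if (areaWord Q.poly).count 0 = s then Xq ^ dinvStat Q.poly * Xt ^ uArea Q else 0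

/- ## Two cars parking functions -/

/-- A two-cars parking function of size `N`, encoded by its area word `a` and its
labels `l`: `a` is the area word of a Dyck path (`a₀ = 0` and `a` increases by at most
`1` at each step), the labels are `1` or `2` and strictly increase bottom to top within
each column (two consecutive north steps lie in the same column exactly when the area
word increases by `1`). -/
structure TwoCarsPF (N : ℕ) where
  a : Fin N → ℕ
  l : Fin N → ℕ
  a_first : ∀ i : Fin N, (i : ℕ) = 0 → a i = 0
  a_step : ∀ i j : Fin N, (i : ℕ) + 1 = (j : ℕ) → a j ≤ a i + 1
  col_incr : ∀ i j : Fin N, (i : ℕ) + 1 = (j : ℕ) → a j = a i + 1 → l i < l j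
  l_one_le : ∀ i, 1 ≤ l i
  l_le_two : ∀ i, l i ≤ 2

/-- `dinv` of a (two-cars) parking function. -/
def pfDinv {N : ℕ} (F : TwoCarsPF N) : ℕ :=
  (univ.filter fun p : Fin N × Fin N =>
    p.1 < p.2 ∧ ((F.a p.1 = F.a p.2 ∧ F.l p.1 < F.l p.2) ∨
      (F.a p.1 = F.a p.2 + 1 ∧ F.l p.2 < F.l p.1))).card

/-- A rise of a parking function: an index whose area word entry is one more than the
previous one. -/
def IsPFRise {N : ℕ} (F : TwoCarsPF N) (i : Fin N) : Prop :=
  ∃ j : Fin N, (j : ℕ) + 1 = (i : ℕ) ∧ F.a i = F.a j + 1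

/-- A two-cars parking function of size `m+n` with `n` labels equal to `1`, `m` labels
equal to `2`, and `k` decorated rises. -/
structure DecTwoCarsPF (m n k : ℕ) where
  pf : TwoCarsPF (m + n)
  ones_count : (univ.filter fun i => pf.l i = 1).card = n
  twos_count : (univ.filter fun i => pf.l i = 2).card = m
  marks : Finset (Fin (m + n))
  marks_card : marks.card = k
  marks_rise : ∀ i ∈ marks, IsPFRise pf i

/-- `underlined-area` of a decorated parking function: the sum of the area word entries
over the non-marked indices. -/
def pfUArea {m n k : ℕ} (F : DecTwoCarsPF m n k) : ℕ :=
  ∑ i ∈ univ \ F.marks, F.pf.a i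

/-- The number of labels equal to `2` lying on the main diagonal. -/
def diagTwos {N : ℕ} (F : TwoCarsPF N) : ℕ :=
  (univ.filter fun i => F.a i = 0 ∧ F.l i = 2).card

/-- `Tqt★(a,b;s;k)`: the `(dinv, underlined-area)` `q,t`-enumerator of two-cars parking
functions of size `a+b` with `b` labels equal to `1`, `a` labels equal to `2`, exactly
`s-1` labels equal to `2` on the main diagonal, and `k` decorated rises. -/
noncomputable def Tstar (a b s k : ℕ) : MvPolynomial (Fin 2) ℤ :=
  ∑ᶠ F : DecTwoCarsPF a b k,
    if diagTwos F.pf + 1 = s then Xq ^ pfDinv F.pf * Xt ^ pfUArea F else 0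

/- ## Partially labelled Dyck paths (all rises decorated, all valleys blank) -/

/-- A valley of a Dyck path (in terms of its area word): a north step preceded by an
east step. -/
def IsValleyW {N : ℕ} (a : Fin N → ℕ) (i : Fin N) : Prop :=
  ∃ j : Fin N, (j : ℕ) + 1 = (i : ℕ) ∧ a i ≤ a j

/-- A rise of a Dyck path (in terms of its area word): a north step preceded by a north
step. -/
def IsRiseW {N : ℕ} (a : Fin N → ℕ) (i : Fin N) : Prop :=
  ∃ j : Fin N, (j : ℕ) + 1 = (i : ℕ) ∧ a i = a j + 1

instance {N : ℕ} (a : Fin N → ℕ) : DecidablePred (IsValleyW a) := fun i =>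
  inferInstanceAs (Decidable (∃ j : Fin N, (j : ℕ) + 1 = (i : ℕ) ∧ a i ≤ a j))

instance {N : ℕ} (a : Fin N → ℕ) : DecidablePred (IsRiseW a) := fun i =>
  inferInstanceAs (Decidable (∃ j : Fin N, (j : ℕ) + 1 = (i : ℕ) ∧ a i = a j + 1))

/-- An element of `PLDP(m,n)^{★n}`: a partially labelled Dyck path of size `m+n+1`
(encoded by the area word `a` of the Dyck path and the labels `l` of its north steps,
with `0` denoting a blank) with `n+1` positive labels and `m` blanks, in which every
valley is a blank, every blank is a valley, labels strictly increase bottom to top in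
each column, and every rise is decorated. -/
structure PLDPall (m n : ℕ) where
  a : Fin (m + n + 1) → ℕ
  l : Fin (m + n + 1) → ℕ
  a_first : ∀ i : Fin (m + n + 1), (i : ℕ) = 0 → a i = 0
  a_step : ∀ i j : Fin (m + n + 1), (i : ℕ) + 1 = (j : ℕ) → a j ≤ a i + 1
  col_incr : ∀ i j : Fin (m + n + 1), (i : ℕ) + 1 = (j : ℕ) → a j = a i + 1 → l i < l j
  blank_iff_valley : ∀ i, l i = 0 ↔ IsValleyW a i
  blank_count : (univ.filter fun i => l i = 0).card = m

/-- `underlined-area` of an element of `PLDP(m,n)^{★n}`: the sum of the area word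
entries over the north steps that are not (decorated) rises. -/
def pldpUArea {m n : ℕ} (D : PLDPall m n) : ℕ :=
  ∑ i ∈ univ.filter (fun i => ¬ IsRiseW D.a i), D.a i

/-- A labelled reduced polyomino of size `m × n`: an `m × n` reduced parallelogram
polyomino together with `n+1` positive integer labels, one below the first column
(index `0`) and one on each north step of the red path (the north step with `j` north
steps before it getting the label of index `j+1`), such that labels strictly increase
bottom to top within each column (the label below the first column being treated as an
artificial north step at the very beginning of the red path). -/
structure LabelledRP (m n : ℕ) where
  poly : RedPoly m n
  lab : Fin (n + 1) → ℕ
  lab_pos : ∀ j, 1 ≤ lab j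
  col_incr : ∀ p : Fin (m + n), poly.red p = true →
    ((p : ℕ) = 0 ∨ ∃ q : Fin (m + n), (q : ℕ) + 1 = (p : ℕ) ∧ poly.red q = true) →
    ∀ h : truesBefore poly.red p + 1 < n + 1,
      lab ⟨truesBefore poly.red p, Nat.lt_of_succ_lt h⟩ <
      lab ⟨truesBefore poly.red p + 1, h⟩

/-- The position of each index after stably sorting `Fin N` by the key `κ`. -/
def sortPos {N : ℕ} (κ : Fin N → ℕ) : Equiv.Perm (Fin N) := (Tuple.sort κ).symm

theorem sortPos_lt_iff {N : ℕ} (κ : Fin N → ℕ) (i j : Fin N) :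
    sortPos κ i < sortPos κ j ↔ κ i < κ j ∨ κ i = κ j ∧ i < j := by
  obtain ⟨hmono, hstable⟩ := Tuple.eq_sort_iff.mp (rfl : Tuple.sort κ = Tuple.sort κ)
  have key : ∀ i j : Fin N, sortPos κ i < sortPos κ j → κ i < κ j ∨ κ i = κ j ∧ i < j := by
    intro i j h
    have h1 := hmono h.le
    simp only [sortPos, Function.comp_apply, Equiv.apply_symm_apply] at h1
    rcases h1.lt_or_eq with h2 | h2
    · exact Or.inl h2
    · have h3 := hstable _ _ h
      simp only [sortPos, Equiv.apply_symm_apply] at h3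
      exact Or.inr ⟨h2, h3 h2⟩
  refine ⟨key i j, fun h => ?_⟩
  rcases lt_trichotomy (sortPos κ i) (sortPos κ j) with h1 | h1 | h1
  · exact h1
  · rw [(sortPos κ).injective h1] at h
    omega
  · have := key j i h1
    omega

theorem sortPos_zero {M : ℕ} {κ : Fin (M + 1) → ℕ} (h : κ 0 = 0) : sortPos κ 0 = 0 := by
  by_contra hne
  obtain ⟨i, hi⟩ := (sortPos κ).surjective 0
  have h1 : sortPos κ i < sortPos κ 0 := by rw [hi]; exact Fin.pos_of_ne_zero hne
  rw [sortPos_lt_iff, h] at h1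
  have := Fin.not_lt_zero i
  omega

/-- The lattice path whose steps record the parities (even for north) of the letters of `w`
after stably sorting them by `κ`, the first one being dropped. -/
def sortedPath {M : ℕ} (w κ : Fin (M + 1) → ℕ) (j : Fin M) : Bool :=
  decide (w ((sortPos κ).symm j.succ) % 2 = 0)

section SortedPath

variable {M : ℕ} (w : Fin (M + 1) → ℕ) {κ : Fin (M + 1) → ℕ}

theorem sortPos_symm_succ_ne_zero (h : κ 0 = 0) (j : Fin M) :
    (sortPos κ).symm j.succ ≠ 0 := by
  intro h1
  rw [Equiv.symm_apply_eq, sortPos_zero h] at h1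
  exact Fin.succ_ne_zero j h1

theorem exists_sortPos_eq_succ (h : κ 0 = 0) {e : Fin (M + 1)} (he : e ≠ 0) :
    ∃ j : Fin M, sortPos κ e = j.succ := by
  have : sortPos κ e ≠ 0 := fun h1 => he ((sortPos κ).injective (h1.trans (sortPos_zero h).symm))
  exact ⟨_, (Fin.succ_pred _ this).symm⟩

theorem image_sortPos_filter (h : κ 0 = 0) (Q : Fin (M + 1) → Prop) [DecidablePred Q] :
    (univ.filter fun j : Fin M => Q ((sortPos κ).symm j.succ)).image
      (fun j => (sortPos κ).symm j.succ) = univ.filter fun i => i ≠ 0 ∧ Q i := by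
  ext i
  simp only [mem_image, mem_filter, mem_univ, true_and]
  constructor
  · rintro ⟨j, hj, rfl⟩
    exact ⟨sortPos_symm_succ_ne_zero h j, hj⟩
  · rintro ⟨h0, hQ⟩
    obtain ⟨j, hj⟩ := exists_sortPos_eq_succ h h0
    have : (sortPos κ).symm j.succ = i := by rw [← hj, Equiv.symm_apply_apply]
    exact ⟨j, this ▸ hQ, this⟩

theorem sortPos_symm_succ_injective :
    Function.Injective fun j : Fin M => (sortPos κ).symm j.succ :=
  (sortPos κ).symm.injective.comp (Fin.succ_injective M)

theorem card_filter_sortPos (h : κ 0 = 0) (Q : Fin (M + 1) → Prop) [DecidablePred Q] :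
    (univ.filter fun j : Fin M => Q ((sortPos κ).symm j.succ)).card =
      (univ.filter fun i => i ≠ 0 ∧ Q i).card := by
  rw [← image_sortPos_filter h Q, card_image_of_injective _ sortPos_symm_succ_injective]

theorem truesBefore_sortedPath (h : κ 0 = 0) (j : Fin M) :
    truesBefore (sortedPath w κ) j = (univ.filter fun i => i ≠ 0 ∧ w i % 2 = 0 ∧
      sortPos κ i < sortPos κ ((sortPos κ).symm j.succ)).card := by
  rw [← card_filter_sortPos h, truesBefore]
  congr 1
  ext l
  simp [sortedPath, and_comm]

theorem falsesBefore_sortedPath (h : κ 0 = 0) (j : Fin M) :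
    falsesBefore (sortedPath w κ) j = (univ.filter fun i => i ≠ 0 ∧ w i % 2 = 1 ∧
      sortPos κ i < sortPos κ ((sortPos κ).symm j.succ)).card := by
  rw [← card_filter_sortPos h, falsesBefore]
  congr 1
  ext l
  simp [sortedPath, and_comm]

theorem heightAt_sortedPath (h : κ 0 = 0) (x : ℕ) :
    heightAt (sortedPath w κ) x = (univ.filter fun e => e ≠ 0 ∧ w e % 2 = 0 ∧
      (univ.filter fun i => i ≠ 0 ∧ w i % 2 = 1 ∧ sortPos κ i < sortPos κ e).card ≤ x).card := by
  rw [← card_filter_sortPos h, heightAt]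
  simp only [falsesBefore_sortedPath w h]
  congr 1
  ext l
  simp [sortedPath]

theorem xcoordAt_sortedPath (h : κ 0 = 0) (y : ℕ) :
    xcoordAt (sortedPath w κ) y = (univ.filter fun e => e ≠ 0 ∧ w e % 2 = 1 ∧
      (univ.filter fun i => i ≠ 0 ∧ w i % 2 = 0 ∧ sortPos κ i < sortPos κ e).card ≤ y).card := by
  rw [← card_filter_sortPos h, xcoordAt]
  simp only [truesBefore_sortedPath w h]
  congr 1
  ext l
  simp [sortedPath]

theorem card_sortedPath_true (h : κ 0 = 0) :
    (univ.filter fun j => sortedPath w κ j = true).card =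
      (univ.filter fun i => i ≠ 0 ∧ w i % 2 = 0).card := by
  rw [← card_filter_sortPos h]
  simp [sortedPath]

theorem card_le_sortedPath_true (h : κ 0 = 0) (j : Fin M) :
    (univ.filter fun l => l ≤ j ∧ sortedPath w κ l = true).card =
      (univ.filter fun i => i ≠ 0 ∧ w i % 2 = 0 ∧ sortPos κ i ≤ j.succ).card := by
  rw [← card_filter_sortPos h]
  congr 1
  ext l
  simp [sortedPath, and_comm]

end SortedPath

theorem exists_eq_of_step_le_one {N : ℕ} {w : Fin N → ℕ}
    (step : ∀ i j : Fin N, (i : ℕ) + 1 = (j : ℕ) → w j ≤ w i + 1) {i j : Fin N} (hij : i ≤ j)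
    {c : ℕ} (hi : w i ≤ c) (hj : c ≤ w j) : ∃ l, i ≤ l ∧ l ≤ j ∧ w l = c := by
  obtain ⟨d, hd⟩ : ∃ d, (j : ℕ) = i + d := ⟨j - i, by omega⟩
  induction d generalizing j with
  | zero =>
    have : i = j := by omega
    subst this
    exact ⟨i, le_rfl, le_rfl, by omega⟩
  | succ d ih =>
    rcases hj.lt_or_eq with h | h
    · obtain ⟨j', hj'⟩ : ∃ j' : Fin N, (j' : ℕ) + 1 = j := ⟨⟨i + d, by omega⟩, by simp; omega⟩
      have := step j' j hj'
      obtain ⟨l, h1, h2, h3⟩ := ih (j := j') (by omega) (by omega) (by omega)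
      exact ⟨l, h1, by omega, h3⟩
    · exact ⟨j, hij, le_rfl, h.symm⟩

/-- A word on the encoded alphabet starting with `0`, with no ascent larger than one, with
`n + 1` unbarred letters and `m` barred ones. -/
@[ext] structure LetterWord (m n : ℕ) where
  w : Fin (m + n + 1) → ℕ
  zero : w 0 = 0
  step : ∀ i j : Fin (m + n + 1), (i : ℕ) + 1 = (j : ℕ) → w j ≤ w i + 1
  even_card : (univ.filter fun i => w i % 2 = 0).card = n + 1

namespace LetterWord

variable {m n : ℕ} (W : LetterWord m n)

/-- The key by which the letters are sorted to get the red path. -/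
def redKey (i : Fin (m + n + 1)) : ℕ := (W.w i + 1) / 2

/-- The key by which the letters are sorted to get the green path. -/
def greenKey (i : Fin (m + n + 1)) : ℕ := W.w i / 2

theorem redKey_zero : W.redKey 0 = 0 := by simp [redKey, W.zero]

theorem greenKey_zero : W.greenKey 0 = 0 := by simp [greenKey, W.zero]

theorem exists_lt_eq {e : Fin (m + n + 1)} {c : ℕ} (hc : c < W.w e) : ∃ l < e, W.w l = c := by
  obtain ⟨l, -, h2, h3⟩ := exists_eq_of_step_le_one W.step (Fin.zero_le e)
    (by rw [W.zero]; exact Nat.zero_le c) hc.le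
  exact ⟨l, lt_of_le_of_ne h2 (by rintro rfl; omega), h3⟩

theorem ne_zero_of_w_ne_zero {i : Fin (m + n + 1)} (h : W.w i ≠ 0) : i ≠ 0 := by
  rintro rfl; exact h W.zero

theorem w_le (i : Fin (m + n + 1)) : W.w i ≤ i := by
  obtain ⟨i, hi⟩ := i
  induction i with
  | zero => exact W.zero.le
  | succ i ih =>
    have h1 := W.step ⟨i, by omega⟩ ⟨i + 1, hi⟩ rfl
    have h2 := ih (by omega)
    simp only at h2 ⊢
    omega

theorem even_ne_zero_card :
    (univ.filter fun i => i ≠ 0 ∧ W.w i % 2 = 0).card = n := by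
  have h : (univ.filter fun i => i ≠ 0 ∧ W.w i % 2 = 0) =
      (univ.filter fun i => W.w i % 2 = 0).erase 0 := by
    ext i; simp
  rw [h, card_erase_of_mem (by simp [W.zero]), W.even_card, Nat.add_sub_cancel]

theorem redPos_lt_greenPos_iff {e i : Fin (m + n + 1)} (he : W.w e % 2 = 0) :
    sortPos W.greenKey i < sortPos W.greenKey e ↔
      sortPos W.redKey i < sortPos W.redKey e ∨
        (i < e ∧ W.w i = W.w e + 1 ∨ e < i ∧ W.w e = W.w i + 1) := by
  have : i = e → W.w i = W.w e := fun h => by rw [h]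
  simp only [sortPos_lt_iff, redKey, greenKey]
  omega

theorem card_lt_perm {N : ℕ} (σ : Equiv.Perm (Fin N)) (e : Fin N) :
    (univ.filter fun i => σ i < σ e).card = σ e := by
  rw [← card_image_of_injective _ σ.injective]
  have : (univ.filter fun i => σ i < σ e).image σ = Iio (σ e) := by
    ext i
    simp only [mem_image, mem_filter, mem_univ, true_and, mem_Iio]
    exact ⟨by rintro ⟨j, h, rfl⟩; exact h, fun h => ⟨σ.symm i, by simpa using h, by simp⟩⟩
  rw [this, Fin.card_Iio]

/-- The number of inversions involving the index `e`. -/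
def invCount (e : Fin (m + n + 1)) : ℕ :=
  (univ.filter fun i => i < e ∧ W.w i = W.w e + 1 ∨ e < i ∧ W.w e = W.w i + 1).card

theorem greenPos_eq {e : Fin (m + n + 1)} (he : W.w e % 2 = 0) :
    (sortPos W.greenKey e : ℕ) = sortPos W.redKey e + W.invCount e := by
  rw [← card_lt_perm, ← card_lt_perm (sortPos W.redKey), invCount, ← card_union_of_disjoint,
    ← filter_or]
  · congr 1
    ext i
    simp only [mem_filter, mem_univ, true_and]
    exact W.redPos_lt_greenPos_iff he
  · rw [disjoint_filter]
    intro i _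
    rw [sortPos_lt_iff]
    simp only [redKey]
    omega

/-- The reduced polyomino whose bounce path is labelled by the letters of the word. -/
def toRedPoly : RedPoly m n where
  red := sortedPath W.w W.redKey
  green := sortedPath W.w W.greenKey
  red_count := by rw [card_sortedPath_true _ W.redKey_zero, even_ne_zero_card]
  green_count := by rw [card_sortedPath_true _ W.greenKey_zero, even_ne_zero_card]
  green_le_red j := by
    rw [card_le_sortedPath_true _ W.redKey_zero, card_le_sortedPath_true _ W.greenKey_zero]
    refine card_le_card fun i hi => ?_
    simp only [mem_filter, mem_univ, true_and] at hi ⊢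
    have := W.greenPos_eq hi.2.1
    exact ⟨hi.1, hi.2.1, by have := hi.2.2; omega⟩

/-- The number of unbarred letters, the first one excepted, of numeric value less than `k`. -/
def evenBelow (k : ℕ) : ℕ := (univ.filter fun i => i ≠ 0 ∧ W.w i % 2 = 0 ∧ W.w i < 2 * k).card

/-- The number of barred letters of numeric value less than `k`. -/
def oddBelow (k : ℕ) : ℕ := (univ.filter fun i => i ≠ 0 ∧ W.w i % 2 = 1 ∧ W.w i < 2 * k).card

theorem card_odd_redPos_lt_le_iff {e : Fin (m + n + 1)} (he : W.w e % 2 = 0) (k : ℕ) :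
    (univ.filter fun i => i ≠ 0 ∧ W.w i % 2 = 1 ∧
      sortPos W.redKey i < sortPos W.redKey e).card ≤ W.oddBelow k ↔ W.w e < 2 * (k + 1) := by
  constructor
  · contrapose!
    intro h
    obtain ⟨l, hl, hw⟩ := W.exists_lt_eq (e := e) (c := 2 * k + 1) (by omega)
    refine card_lt_card (ssubset_iff_of_subset ?_ |>.mpr ⟨l, ?_, ?_⟩)
    · intro i
      simp only [mem_filter, mem_univ, true_and, sortPos_lt_iff, redKey]
      omega
    · have := W.ne_zero_of_w_ne_zero (i := l) (by omega)
      simp only [mem_filter, mem_univ, true_and, sortPos_lt_iff, redKey]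
      omega
    · simp only [mem_filter, mem_univ, true_and]
      omega
  · intro h
    refine card_le_card fun i => ?_
    simp only [mem_filter, mem_univ, true_and, sortPos_lt_iff, redKey]
    omega

theorem card_even_greenPos_lt_le_iff {e : Fin (m + n + 1)} (he : W.w e % 2 = 1) (k : ℕ) :
    (univ.filter fun i => i ≠ 0 ∧ W.w i % 2 = 0 ∧
      sortPos W.greenKey i < sortPos W.greenKey e).card ≤ W.evenBelow (k + 1) ↔
      W.w e < 2 * (k + 1) := by
  constructor
  · contrapose!
    intro h
    obtain ⟨l, hl, hw⟩ := W.exists_lt_eq (e := e) (c := 2 * (k + 1)) (by omega)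
    refine card_lt_card (ssubset_iff_of_subset ?_ |>.mpr ⟨l, ?_, ?_⟩)
    · intro i
      simp only [mem_filter, mem_univ, true_and, sortPos_lt_iff, greenKey]
      omega
    · have := W.ne_zero_of_w_ne_zero (i := l) (by omega)
      simp only [mem_filter, mem_univ, true_and, sortPos_lt_iff, greenKey]
      omega
    · simp only [mem_filter, mem_univ, true_and]
      omega
  · intro h
    refine card_le_card fun i => ?_
    simp only [mem_filter, mem_univ, true_and, sortPos_lt_iff, greenKey]
    omega

theorem heightAt_red (k : ℕ) :
    heightAt W.toRedPoly.red (W.oddBelow k) = W.evenBelow (k + 1) := by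
  rw [toRedPoly, heightAt_sortedPath _ W.redKey_zero, evenBelow]
  congr 1
  ext e
  simp only [mem_filter, mem_univ, true_and]
  exact and_congr_right fun _ => and_congr_right fun he => W.card_odd_redPos_lt_le_iff he k

theorem xcoordAt_green (k : ℕ) :
    xcoordAt W.toRedPoly.green (W.evenBelow (k + 1)) = W.oddBelow (k + 1) := by
  rw [toRedPoly, xcoordAt_sortedPath _ W.greenKey_zero, oddBelow]
  congr 1
  ext e
  simp only [mem_filter, mem_univ, true_and]
  exact and_congr_right fun _ => and_congr_right fun he => W.card_even_greenPos_lt_le_iff he k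

theorem bouncePt_toRedPoly (k : ℕ) :
    bouncePt W.toRedPoly k = (W.oddBelow k, W.evenBelow k) := by
  induction k with
  | zero => simp [bouncePt, oddBelow, evenBelow]
  | succ k ih => rw [bouncePt, ih, heightAt_red, xcoordAt_green]

theorem vertLabel_toRedPoly {j : Fin (m + n)}
    (hj : W.toRedPoly.red j = true) :
    vertLabel W.toRedPoly (truesBefore W.toRedPoly.red j) =
      W.w ((sortPos W.redKey).symm j.succ) / 2 := by
  simp only [vertLabel, bouncePt_toRedPoly]
  rw [toRedPoly, truesBefore_sortedPath _ W.redKey_zero]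
  have he : W.w ((sortPos W.redKey).symm j.succ) % 2 = 0 := by
    simpa [toRedPoly, sortedPath] using hj
  have he0 := sortPos_symm_succ_ne_zero W.redKey_zero j
  generalize (sortPos W.redKey).symm j.succ = e at he he0
  have hle := W.w_le e
  rw [← card_range (W.w e / 2)]
  congr 1
  ext k
  simp only [mem_filter, mem_range]
  constructor
  · rintro ⟨-, h⟩
    contrapose! h
    refine card_lt_card (ssubset_iff_of_subset ?_ |>.mpr ⟨e, ?_, ?_⟩)
    · intro i
      simp only [mem_filter, mem_univ, true_and, sortPos_lt_iff, redKey]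
      omega
    · simp only [mem_filter, mem_univ, true_and]
      omega
    · simp
  · intro h
    refine ⟨by omega, card_le_card fun i => ?_⟩
    simp only [mem_filter, mem_univ, true_and, sortPos_lt_iff, redKey]
    omega

theorem horLabel_toRedPoly {j : Fin (m + n)}
    (hj : W.toRedPoly.green j = false) :
    horLabel W.toRedPoly (falsesBefore W.toRedPoly.green j) =
      W.w ((sortPos W.greenKey).symm j.succ) / 2 := by
  simp only [horLabel, bouncePt_toRedPoly]
  rw [toRedPoly, falsesBefore_sortedPath _ W.greenKey_zero]
  have he : W.w ((sortPos W.greenKey).symm j.succ) % 2 = 1 := by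
    simpa [toRedPoly, sortedPath] using hj
  have he0 := sortPos_symm_succ_ne_zero W.greenKey_zero j
  generalize (sortPos W.greenKey).symm j.succ = e at he he0
  have hle := W.w_le e
  rw [← card_range (W.w e / 2)]
  congr 1
  ext k
  simp only [mem_filter, mem_range]
  constructor
  · rintro ⟨-, h⟩
    contrapose! h
    refine card_lt_card (ssubset_iff_of_subset ?_ |>.mpr ⟨e, ?_, ?_⟩)
    · intro i
      simp only [mem_filter, mem_univ, true_and, sortPos_lt_iff, greenKey]
      omega
    · simp only [mem_filter, mem_univ, true_and]
      omega
    · simp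
  · intro h
    refine ⟨by omega, card_le_card fun i => ?_⟩
    simp only [mem_filter, mem_univ, true_and, sortPos_lt_iff, greenKey]
    omega

theorem isRedValley_toRedPoly_iff (j : Fin (m + n)) :
    IsRedValley W.toRedPoly j ↔
      ∃ i : Fin (m + n + 1), (i : ℕ) + 1 = (sortPos W.redKey).symm j.succ ∧ W.w i % 2 = 1 ∧
        W.w ((sortPos W.redKey).symm j.succ) = W.w i + 1 := by
  set e := (sortPos W.redKey).symm j.succ with he
  have hpos : sortPos W.redKey e = j.succ := by rw [he, Equiv.apply_symm_apply]
  constructor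
  · rintro ⟨hj, i, hij, hi⟩
    set p := (sortPos W.redKey).symm i.succ with hp
    have hpp : sortPos W.redKey p = i.succ := by rw [hp, Equiv.apply_symm_apply]
    have hwe : W.w e % 2 = 0 := by simpa [toRedPoly, sortedPath] using hj
    have hwp : W.w p % 2 = 1 := by simpa [toRedPoly, sortedPath] using hi
    have hlt : sortPos W.redKey p < sortPos W.redKey e := by
      rw [hpos, hpp, Fin.lt_def]; simp; omega
    have hnot : ∀ l, ¬ (sortPos W.redKey p < sortPos W.redKey l ∧
        sortPos W.redKey l < sortPos W.redKey e) := by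
      intro l
      simp only [hpos, hpp, Fin.lt_def, Fin.val_succ]
      omega
    simp only [sortPos_lt_iff, redKey] at hlt hnot
    obtain ⟨l, hle, hwl⟩ := W.exists_lt_eq (e := e) (c := W.w e - 1) (by omega)
    have hl := hnot l
    have hwpe : W.w p + 1 = W.w e := by omega
    have hpe : p < e := by omega
    refine ⟨p, ?_, hwp, hwpe.symm⟩
    by_contra hne
    have hpe' : (p : ℕ) < e := hpe
    obtain ⟨q, hq⟩ : ∃ q : Fin (m + n + 1), (q : ℕ) + 1 = e := ⟨⟨e - 1, by omega⟩, by simp; omega⟩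
    have hstep := W.step q e hq
    have hqn := hnot q
    obtain ⟨r, h1, h2, h3⟩ := exists_eq_of_step_le_one W.step (i := p) (j := q) (by omega)
      (c := W.w e) (by omega) (by omega)
    have hrn := hnot r
    have : r ≠ p := by rintro rfl; omega
    omega
  · rintro ⟨p, hpe, hwp, hwe⟩
    obtain ⟨i, hi⟩ := exists_sortPos_eq_succ W.redKey_zero
      (W.ne_zero_of_w_ne_zero (i := p) (by omega))
    have hp : (sortPos W.redKey).symm i.succ = p := by rw [← hi, Equiv.symm_apply_apply]
    refine ⟨?_, i, ?_, ?_⟩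
    · simp only [toRedPoly, sortedPath, ← he, decide_eq_true_eq]
      omega
    · have hlt : sortPos W.redKey p < sortPos W.redKey e := by
        simp only [sortPos_lt_iff, redKey]
        omega
      rw [hpos, hi, Fin.lt_def, Fin.val_succ, Fin.val_succ] at hlt
      by_contra hne
      have hlt' : (i : ℕ) + 1 < m + n := by omega
      set l := (sortPos W.redKey).symm (Fin.succ ⟨i + 1, hlt'⟩) with hl
      have hll : sortPos W.redKey l = Fin.succ ⟨i + 1, hlt'⟩ := by
        rw [hl, Equiv.apply_symm_apply]
      have h1 : sortPos W.redKey p < sortPos W.redKey l := by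
        rw [hll, hi, Fin.lt_def]; simp
      have h2 : sortPos W.redKey l < sortPos W.redKey e := by
        rw [hll, hpos, Fin.lt_def]; simp; omega
      simp only [sortPos_lt_iff, redKey] at h1 h2
      omega
    · simp only [toRedPoly, sortedPath, hp]
      simp [hwp]

end LetterWord

theorem truesBefore_lt_truesBefore {N : ℕ} {p : Fin N → Bool} {i j : Fin N} (hi : p i = true)
    (hij : i < j) : truesBefore p i < truesBefore p j := by
  refine card_lt_card (ssubset_iff_of_subset ?_ |>.mpr ⟨i, ?_, ?_⟩)
  · intro l
    simp only [mem_filter, mem_univ, true_and]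
    exact fun h => ⟨h.1.trans hij, h.2⟩
  · simp [hi, hij]
  · simp

theorem injOn_truesBefore {N : ℕ} (p : Fin N → Bool) :
    Set.InjOn (truesBefore p) (univ.filter fun j => p j = true) := by
  intro i hi j hj h
  simp only [coe_filter, mem_univ, true_and, Set.mem_ofPred_eq] at hi hj
  by_contra hne
  rcases lt_or_gt_of_ne hne with h1 | h1
  · exact (truesBefore_lt_truesBefore hi h1).ne h
  · exact (truesBefore_lt_truesBefore hj h1).ne' h

theorem image_truesBefore {N : ℕ} (p : Fin N → Bool) :
    (univ.filter fun j => p j = true).image (truesBefore p) =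
      range (univ.filter fun j => p j = true).card := by
  refine eq_of_subset_of_card_le ?_ ?_
  · intro y
    simp only [mem_image, mem_filter, mem_univ, true_and, mem_range]
    rintro ⟨j, hj, rfl⟩
    refine card_lt_card (ssubset_iff_of_subset ?_ |>.mpr ⟨j, ?_, ?_⟩)
    · intro l; simp
    · simpa using hj
    · simp
  · rw [card_image_of_injOn (injOn_truesBefore p), card_range]

theorem falsesBefore_eq {N : ℕ} (p : Fin N → Bool) :
    falsesBefore p = truesBefore fun i => !p i := by
  ext j; simp [falsesBefore, truesBefore]

theorem RedPoly.card_green_false {m n : ℕ} (P : RedPoly m n) :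
    (univ.filter fun j => P.green j = false).card = m := by
  have h := card_filter_add_card_filter_not (s := univ) (fun j => P.green j = true)
  simp only [Bool.not_eq_true, P.green_count, card_univ, Fintype.card_fin] at h
  omega

namespace LetterWord

variable {m n : ℕ} (W : LetterWord m n)

theorem sum_vertLabel_sdiff {M : Finset (Fin (m + n))}
    (hM : ∀ j ∈ M, W.toRedPoly.red j = true) :
    ∑ y ∈ range n \ M.image (rowOf W.toRedPoly), vertLabel W.toRedPoly y =
      ∑ i with i ∉ M.image (fun j => (sortPos W.redKey).symm j.succ) ∧ W.w i % 2 = 0,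
        W.w i / 2 := by
  set S := univ.filter fun j => W.toRedPoly.red j = true with hS
  have hinj : Set.InjOn (rowOf W.toRedPoly) S := injOn_truesBefore W.toRedPoly.red
  have hMS : M ⊆ S := fun j hj => by simp [hS, hM j hj]
  have h1 : range n \ M.image (rowOf W.toRedPoly) = (S \ M).image (rowOf W.toRedPoly) := by
    have h2 := image_truesBefore W.toRedPoly.red
    rw [W.toRedPoly.red_count] at h2
    rw [← h2]
    exact (image_sdiff_of_injOn hinj hMS).symm
  rw [h1, sum_image (hinj.mono (by exact_mod_cast sdiff_subset))]
  have h3 : ∀ j ∈ S \ M, vertLabel W.toRedPoly (rowOf W.toRedPoly j) =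
      W.w ((sortPos W.redKey).symm j.succ) / 2 := fun j hj =>
    W.vertLabel_toRedPoly (by simpa [hS] using (mem_sdiff.mp hj).1)
  rw [sum_congr rfl h3, ← sum_image (f := fun i => W.w i / 2)
    (g := fun j : Fin (m + n) => (sortPos W.redKey).symm j.succ)
    sortPos_symm_succ_injective.injOn, image_sdiff_of_injOn sortPos_symm_succ_injective.injOn hMS,
    hS]
  have h4 : (univ.filter fun j => W.toRedPoly.red j = true).image
      (fun j => (sortPos W.redKey).symm j.succ) = univ.filter fun i => i ≠ 0 ∧ W.w i % 2 = 0 := by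
    rw [← image_sortPos_filter W.redKey_zero]
    simp [toRedPoly, sortedPath]
  rw [h4]
  refine sum_subset (fun i => ?_) (fun i => ?_)
  · simp only [mem_sdiff, mem_filter, mem_univ, true_and]
    tauto
  · simp only [mem_sdiff, mem_filter, mem_univ, true_and]
    intro h h'
    have : i = 0 := by tauto
    simp [this, W.zero]

theorem sum_horLabel :
    ∑ x ∈ range m, horLabel W.toRedPoly x = ∑ i with W.w i % 2 = 1, W.w i / 2 := by
  have hinj := injOn_truesBefore fun j => !W.toRedPoly.green j
  have h2 := image_truesBefore fun j => !W.toRedPoly.green j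
  simp only [← falsesBefore_eq, Bool.not_eq_true', W.toRedPoly.card_green_false] at h2 hinj
  rw [← h2, sum_image hinj]
  have h3 : ∀ j ∈ univ.filter fun j => W.toRedPoly.green j = false,
      horLabel W.toRedPoly (falsesBefore W.toRedPoly.green j) =
      W.w ((sortPos W.greenKey).symm j.succ) / 2 := fun j hj =>
    W.horLabel_toRedPoly (by simpa using hj)
  rw [sum_congr rfl h3, ← sum_image (f := fun i => W.w i / 2)
    (g := fun j : Fin (m + n) => (sortPos W.greenKey).symm j.succ)
    sortPos_symm_succ_injective.injOn]
  refine sum_congr ?_ fun _ _ => rfl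
  have h5 := image_sortPos_filter W.greenKey_zero fun i => W.w i % 2 = 1
  simp only [toRedPoly, sortedPath, decide_eq_false_iff_not, Nat.mod_two_not_eq_zero]
  rw [h5]
  ext i
  simp only [mem_filter, mem_univ, true_and, and_iff_right_iff_imp]
  exact fun h => W.ne_zero_of_w_ne_zero (by omega)

theorem zeroLabelCount_toRedPoly :
    zeroLabelCount W.toRedPoly + 1 = (univ.filter fun i => W.w i = 0).card := by
  have hinj := injOn_truesBefore W.toRedPoly.red
  have h2 := image_truesBefore W.toRedPoly.red
  rw [W.toRedPoly.red_count] at h2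
  rw [zeroLabelCount, ← h2, filter_image, card_image_of_injOn
    (hinj.mono (by exact_mod_cast filter_subset _ _)), filter_filter]
  have h3 : (univ.filter fun j => W.toRedPoly.red j = true ∧
      vertLabel W.toRedPoly (truesBefore W.toRedPoly.red j) = 0) =
      univ.filter fun j : Fin (m + n) => W.w ((sortPos W.redKey).symm j.succ) = 0 := by
    refine filter_congr fun j _ => ?_
    have h4 : W.toRedPoly.red j = true ↔ W.w ((sortPos W.redKey).symm j.succ) % 2 = 0 := by
      simp [toRedPoly, sortedPath]
    constructor
    · rintro ⟨h5, h6⟩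
      rw [W.vertLabel_toRedPoly h5] at h6
      have := h4.mp h5
      omega
    · intro h5
      have h6 := h4.mpr (by omega)
      exact ⟨h6, by rw [W.vertLabel_toRedPoly h6, h5]⟩
  rw [h3, card_filter_sortPos W.redKey_zero fun i => W.w i = 0]
  have h6 : (univ.filter fun i => i ≠ 0 ∧ W.w i = 0) =
      (univ.filter fun i => W.w i = 0).erase 0 := by
    ext i; simp
  rw [h6, card_erase_add_one (by simp [W.zero])]

theorem sum_card_red :
    ∑ j, (univ.filter fun l => l ≤ j ∧ W.toRedPoly.red l = true).card =
      ∑ j, (univ.filter fun l => l ≤ j ∧ W.toRedPoly.green l = true).card +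
        ∑ e with W.w e % 2 = 0, W.invCount e := by
  have h1 : ∀ j : Fin (m + n),
      (univ.filter fun l => l ≤ j ∧ W.toRedPoly.red l = true).card =
      (univ.filter fun l => l ≤ j ∧ W.toRedPoly.green l = true).card +
      (univ.filter fun e => (e ≠ 0 ∧ W.w e % 2 = 0) ∧
        sortPos W.redKey e ≤ j.succ ∧ j.succ < sortPos W.greenKey e).card := by
    intro j
    have hr : (univ.filter fun l => l ≤ j ∧ W.toRedPoly.red l = true).card = _ :=
      card_le_sortedPath_true W.w W.redKey_zero j
    have hg : (univ.filter fun l => l ≤ j ∧ W.toRedPoly.green l = true).card = _ :=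
      card_le_sortedPath_true W.w W.greenKey_zero j
    rw [hr, hg, ← card_union_of_disjoint, ← filter_or]
    · congr 1
      refine filter_congr fun i _ => ?_
      constructor
      · rintro ⟨h0, h1, h2⟩
        rcases le_or_gt (sortPos W.greenKey i) j.succ with h3 | h3
        · exact Or.inl ⟨h0, h1, h3⟩
        · exact Or.inr ⟨⟨h0, h1⟩, h2, h3⟩
      · rintro (⟨h0, h1, h2⟩ | ⟨⟨h0, h1⟩, h2, h3⟩)
        · have := W.greenPos_eq h1
          exact ⟨h0, h1, by omega⟩
        · exact ⟨h0, h1, h2⟩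
    · rw [disjoint_filter]
      intro i _ h h'
      exact absurd h.2.2 (not_le.mpr h'.2.2)
  rw [sum_congr rfl fun j _ => h1 j, sum_add_distrib]
  congr 1
  have h2 : ∀ e, W.w e % 2 = 0 → e ≠ 0 → (univ.filter fun j : Fin (m + n) =>
      sortPos W.redKey e ≤ j.succ ∧ j.succ < sortPos W.greenKey e).card = W.invCount e := by
    intro e he h0
    rw [← card_image_of_injective _ (Fin.succ_injective _)]
    obtain ⟨j0, hj0⟩ := exists_sortPos_eq_succ W.redKey_zero h0
    have : (univ.filter fun j : Fin (m + n) => sortPos W.redKey e ≤ j.succ ∧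
        j.succ < sortPos W.greenKey e).image Fin.succ =
        Ico (sortPos W.redKey e) (sortPos W.greenKey e) := by
      ext q
      simp only [mem_image, mem_filter, mem_univ, true_and, mem_Ico]
      constructor
      · rintro ⟨j, h, rfl⟩; exact h
      · intro h
        have : q ≠ 0 := by
          rintro rfl
          rw [hj0] at h
          exact absurd h.1 (by simp)
        obtain ⟨j, rfl⟩ := Fin.exists_succ_eq.mpr this
        exact ⟨j, h, rfl⟩
    rw [this, Fin.card_Ico, W.greenPos_eq he, Nat.add_sub_cancel_left]
  simp only [← filter_filter (fun e => e ≠ 0 ∧ W.w e % 2 = 0)]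
  refine (sum_card_bipartiteAbove_eq_sum_card_bipartiteBelow
    (s := univ) (t := univ.filter fun e => e ≠ 0 ∧ W.w e % 2 = 0)
    (fun j e => sortPos W.redKey e ≤ Fin.succ j ∧ Fin.succ j < sortPos W.greenKey e)).trans ?_
  simp only [bipartiteBelow]
  rw [sum_congr rfl fun e he => h2 e (by simp at he; exact he.2) (by simp at he; exact he.1)]
  refine sum_subset (fun i => ?_) (fun i => ?_)
  · simp only [mem_filter, mem_univ, true_and]
    exact fun h => h.2
  · simp only [mem_filter, mem_univ, true_and]
    intro h h'
    have : i = 0 := by tauto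
    subst this
    simp [invCount, W.zero]

theorem sum_invCount :
    ∑ e with W.w e % 2 = 0, W.invCount e =
      (univ.filter fun p : Fin (m + n + 1) × Fin (m + n + 1) =>
        p.1 < p.2 ∧ W.w p.1 = W.w p.2 + 1).card := by
  simp only [invCount, card_filter, sum_filter, ← univ_product_univ, sum_product]
  have h : ∀ e, (if W.w e % 2 = 0 then
      ∑ i, (if i < e ∧ W.w i = W.w e + 1 ∨ e < i ∧ W.w e = W.w i + 1 then 1 else 0) else 0) =
      (∑ i, if W.w e % 2 = 0 ∧ i < e ∧ W.w i = W.w e + 1 then 1 else 0) +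
      ∑ i, if W.w e % 2 = 0 ∧ e < i ∧ W.w e = W.w i + 1 then 1 else 0 := by
    intro e
    rw [← sum_add_distrib]
    split_ifs with he
    · refine sum_congr rfl fun i _ => ?_
      split_ifs <;> omega
    · simp [he]
  rw [sum_congr rfl fun e _ => h e, sum_add_distrib, sum_comm, ← sum_add_distrib]
  refine sum_congr rfl fun i _ => ?_
  rw [← sum_add_distrib]
  refine sum_congr rfl fun j _ => ?_
  split_ifs <;> omega

/-- The number of occurrences of the letter `c`, other than at the first index, before `e`. -/
def occBefore (c : ℕ) (e : Fin (m + n + 1)) : ℕ :=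
  (univ.filter fun i => i ≠ 0 ∧ i < e ∧ W.w i = c).card

theorem evenBelow_succ (v : ℕ) :
    W.evenBelow (v + 1) = W.evenBelow v + (univ.filter fun i => i ≠ 0 ∧ W.w i = 2 * v).card := by
  rw [evenBelow, evenBelow, ← card_union_of_disjoint, ← filter_or]
  · congr 1
    exact filter_congr fun i _ => by omega
  · exact disjoint_filter.mpr fun i _ => by omega

theorem oddBelow_succ (v : ℕ) :
    W.oddBelow (v + 1) =
      W.oddBelow v + (univ.filter fun i => i ≠ 0 ∧ W.w i = 2 * v + 1).card := by
  rw [oddBelow, oddBelow, ← card_union_of_disjoint, ← filter_or]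
  · congr 1
    exact filter_congr fun i _ => by omega
  · exact disjoint_filter.mpr fun i _ => by omega

theorem truesBefore_red (j : Fin (m + n)) {v : ℕ}
    (hv : W.w ((sortPos W.redKey).symm j.succ) = 2 * v) :
    truesBefore W.toRedPoly.red j =
      W.evenBelow v + W.occBefore (2 * v) ((sortPos W.redKey).symm j.succ) := by
  refine (truesBefore_sortedPath W.w W.redKey_zero j).trans ?_
  rw [evenBelow, occBefore, ← card_union_of_disjoint, ← filter_or]
  · congr 1
    refine filter_congr fun i _ => ?_
    rw [sortPos_lt_iff, redKey, redKey]
    omega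
  · exact disjoint_filter.mpr fun i _ => by omega

theorem falsesBefore_red (j : Fin (m + n)) {v : ℕ}
    (hv : W.w ((sortPos W.redKey).symm j.succ) = 2 * (v + 1)) :
    falsesBefore W.toRedPoly.red j =
      W.oddBelow v + W.occBefore (2 * v + 1) ((sortPos W.redKey).symm j.succ) := by
  refine (falsesBefore_sortedPath W.w W.redKey_zero j).trans ?_
  rw [oddBelow, occBefore, ← card_union_of_disjoint, ← filter_or]
  · congr 1
    refine filter_congr fun i _ => ?_
    rw [sortPos_lt_iff, redKey, redKey]
    omega
  · exact disjoint_filter.mpr fun i _ => by omega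

theorem truesBefore_green (j : Fin (m + n)) {v : ℕ}
    (hv : W.w ((sortPos W.greenKey).symm j.succ) = 2 * v + 1) :
    truesBefore W.toRedPoly.green j =
      W.evenBelow v + W.occBefore (2 * v) ((sortPos W.greenKey).symm j.succ) := by
  refine (truesBefore_sortedPath W.w W.greenKey_zero j).trans ?_
  rw [evenBelow, occBefore, ← card_union_of_disjoint, ← filter_or]
  · congr 1
    refine filter_congr fun i _ => ?_
    rw [sortPos_lt_iff, greenKey, greenKey]
    omega
  · exact disjoint_filter.mpr fun i _ => by omega

theorem falsesBefore_green (j : Fin (m + n)) {v : ℕ}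
    (hv : W.w ((sortPos W.greenKey).symm j.succ) = 2 * v + 1) :
    falsesBefore W.toRedPoly.green j =
      W.oddBelow v + W.occBefore (2 * v + 1) ((sortPos W.greenKey).symm j.succ) := by
  refine (falsesBefore_sortedPath W.w W.greenKey_zero j).trans ?_
  rw [oddBelow, occBefore, ← card_union_of_disjoint, ← filter_or]
  · congr 1
    refine filter_congr fun i _ => ?_
    rw [sortPos_lt_iff, greenKey, greenKey]
    omega
  · exact disjoint_filter.mpr fun i _ => by omega

variable {W} {W' : LetterWord m n}

theorem evenBelow_congr (h : W.toRedPoly = W'.toRedPoly) (k : ℕ) :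
    W.evenBelow k = W'.evenBelow k := by
  have h1 := W.bouncePt_toRedPoly k
  rw [h, W'.bouncePt_toRedPoly] at h1
  exact (congrArg Prod.snd h1).symm

theorem oddBelow_congr (h : W.toRedPoly = W'.toRedPoly) (k : ℕ) :
    W.oddBelow k = W'.oddBelow k := by
  have h1 := W.bouncePt_toRedPoly k
  rw [h, W'.bouncePt_toRedPoly] at h1
  exact (congrArg Prod.fst h1).symm

theorem card_letter_congr (h : W.toRedPoly = W'.toRedPoly) (c : ℕ) :
    (univ.filter fun i => i ≠ 0 ∧ W.w i = c).card =
      (univ.filter fun i => i ≠ 0 ∧ W'.w i = c).card := by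
  rcases Nat.even_or_odd' c with ⟨v, rfl | rfl⟩
  · have h1 := W.evenBelow_succ v
    have h2 := W'.evenBelow_succ v
    rw [evenBelow_congr h, evenBelow_congr h v] at h1
    omega
  · have h1 := W.oddBelow_succ v
    have h2 := W'.oddBelow_succ v
    rw [oddBelow_congr h, oddBelow_congr h v] at h1
    omega

theorem occBefore_congr (h : W.toRedPoly = W'.toRedPoly) {e e' : Fin (m + n + 1)} {c : ℕ}
    (he : W.w e = c + 1) (he' : W'.w e' = c + 1)
    (hocc : W.occBefore (c + 1) e = W'.occBefore (c + 1) e') :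
    W.occBefore c e = W'.occBefore c e' := by
  have he0 := W.ne_zero_of_w_ne_zero (i := e) (by omega)
  have he0' := W'.ne_zero_of_w_ne_zero (i := e') (by omega)
  rcases Nat.even_or_odd' c with ⟨v, rfl | rfl⟩
  · obtain ⟨j, hj⟩ := exists_sortPos_eq_succ W.greenKey_zero he0
    obtain ⟨j', hj'⟩ := exists_sortPos_eq_succ W'.greenKey_zero he0'
    obtain rfl : e = (sortPos W.greenKey).symm j.succ := by rw [← hj, Equiv.symm_apply_apply]
    obtain rfl : e' = (sortPos W'.greenKey).symm j'.succ := by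
      rw [← hj', Equiv.symm_apply_apply]
    have h1 := W.falsesBefore_green j he
    have h2 := W'.falsesBefore_green j' he'
    have h3 := W.truesBefore_green j he
    have h4 := W'.truesBefore_green j' he'
    have hjj : j = j' := by
      apply injOn_truesBefore fun j => !W'.toRedPoly.green j
      · rw [← h]; simp [toRedPoly, sortedPath]; omega
      · simp [toRedPoly, sortedPath]; omega
      · rw [← falsesBefore_eq, h2, ← hocc, ← oddBelow_congr h, ← h1, h]
    have h5 := evenBelow_congr h v
    subst hjj
    rw [h] at h3
    omega
  · obtain ⟨j, hj⟩ := exists_sortPos_eq_succ W.redKey_zero he0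
    obtain ⟨j', hj'⟩ := exists_sortPos_eq_succ W'.redKey_zero he0'
    obtain rfl : e = (sortPos W.redKey).symm j.succ := by rw [← hj, Equiv.symm_apply_apply]
    obtain rfl : e' = (sortPos W'.redKey).symm j'.succ := by
      rw [← hj', Equiv.symm_apply_apply]
    have h1 := W.truesBefore_red j (v := v + 1) he
    have h2 := W'.truesBefore_red j' (v := v + 1) he'
    have h3 := W.falsesBefore_red j he
    have h4 := W'.falsesBefore_red j' he'
    rw [show 2 * (v + 1) = 2 * v + 1 + 1 by ring] at h1 h2
    have hjj : j = j' := by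
      apply injOn_truesBefore W'.toRedPoly.red
      · rw [← h]; simp [toRedPoly, sortedPath]; omega
      · simp [toRedPoly, sortedPath]; omega
      · rw [h2, ← hocc, ← evenBelow_congr h, ← h1, h]
    have h5 := oddBelow_congr h v
    subst hjj
    rw [h] at h3
    omega

theorem le_of_forall_lt_eq (h : W.toRedPoly = W'.toRedPoly) {p : Fin (m + n + 1)}
    (hp : ∀ i < p, W.w i = W'.w i) : W'.w p ≤ W.w p := by
  by_contra! hlt
  obtain ⟨c, hc⟩ : ∃ c, W'.w p = c + 1 := ⟨W'.w p - 1, by omega⟩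
  have hp0 : p ≠ 0 := W'.ne_zero_of_w_ne_zero (by omega)
  have hocc : ∀ d, W.occBefore d p = W'.occBefore d p := fun d => by
    rw [occBefore, occBefore]
    congr 1
    refine filter_congr fun i _ => ?_
    have := hp i
    constructor <;> rintro ⟨h1, h2, h3⟩ <;> exact ⟨h1, h2, by rw [← h3, this h2]⟩
  have hlt' : W.occBefore (c + 1) p < (univ.filter fun i => i ≠ 0 ∧ W.w i = c + 1).card := by
    rw [hocc, card_letter_congr h]
    refine card_lt_card (ssubset_iff_of_subset ?_ |>.mpr ⟨p, ?_, ?_⟩)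
    · intro i
      simp only [mem_filter, mem_univ, true_and]
      exact fun h1 => ⟨h1.1, h1.2.2⟩
    · simp [hp0, hc]
    · simp
  have hex : (univ.filter fun i => p ≤ i ∧ W.w i = c + 1).Nonempty := by
    by_contra hne
    rw [not_nonempty_iff_eq_empty, filter_eq_empty_iff] at hne
    refine hlt'.not_ge (card_le_card fun i => ?_)
    simp only [mem_filter, mem_univ, true_and]
    intro hi
    have := hne (mem_univ i)
    exact ⟨hi.1, by rw [← not_le]; tauto, hi.2⟩
  obtain ⟨e, he, hmin⟩ := exists_min_image _ id hex
  simp only [mem_filter, mem_univ, true_and, id] at he hmin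
  have hmin' : ∀ i, p ≤ i → i < e → W.w i ≠ c + 1 := fun i h1 h2 h3 =>
    absurd (hmin i ⟨h1, h3⟩) (not_le.mpr h2)
  have hocc_e : W.occBefore (c + 1) e = W'.occBefore (c + 1) p := by
    rw [← hocc, occBefore, occBefore]
    congr 1
    refine filter_congr fun i _ => ?_
    have := hmin' i
    constructor
    · rintro ⟨h1, h2, h3⟩
      refine ⟨h1, ?_, h3⟩
      by_contra h4
      exact this (not_lt.mp h4) h2 h3
    · rintro ⟨h1, h2, h3⟩
      exact ⟨h1, h2.trans_le he.1, h3⟩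
  have hkey := occBefore_congr h he.2 hc hocc_e
  obtain ⟨l, hl1, hl2, hl3⟩ := exists_eq_of_step_le_one W.step he.1 (c := c) (by omega) (by omega)
  refine (hkey.trans (hocc c).symm).not_gt ?_
  refine card_lt_card (ssubset_iff_of_subset ?_ |>.mpr ⟨l, ?_, ?_⟩)
  · intro i
    simp only [mem_filter, mem_univ, true_and]
    exact fun h1 => ⟨h1.1, h1.2.1.trans_le he.1, h1.2.2⟩
  · have : l ≠ e := by rintro rfl; omega
    have hl0 : l ≠ 0 := by rintro rfl; exact hp0 (Fin.le_zero_iff.mp hl1)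
    simp only [mem_filter, mem_univ, true_and]
    exact ⟨hl0, lt_of_le_of_ne hl2 this, hl3⟩
  · simp only [mem_filter, mem_univ, true_and]
    exact fun h1 => absurd h1.2.1 (not_lt.mpr hl1)

theorem toRedPoly_injective :
    Function.Injective (toRedPoly : LetterWord m n → RedPoly m n) := by
  intro W W' h
  ext p
  induction p using WellFoundedLT.induction with
  | ind p ih =>
    exact le_antisymm (le_of_forall_lt_eq h.symm fun i hi => (ih i hi).symm)
      (le_of_forall_lt_eq h ih)

end LetterWord

theorem countP_ofFn_eq_card {α : Type*} {N : ℕ} (f : Fin N → α) (p : α → Bool) :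
    (List.ofFn f).countP p = (univ.filter fun i => p (f i) = true).card := by
  induction N with
  | zero => simp
  | succ N ih =>
    rw [List.ofFn_succ, List.countP_cons, ih, Fin.card_filter_univ_succ', add_comm]

theorem areaWordAux_head_le (h : ℕ) (l : List Bool) : ∀ x ∈ (areaWordAux h l).head?, x ≤ h := by
  induction l generalizing h with
  | nil => simp [areaWordAux]
  | cons b l ih =>
    cases b
    · intro x hx
      exact (ih (h - 1) x hx).trans (Nat.sub_le h 1)
    · simp [areaWordAux]

theorem isChain_areaWordAux (h : ℕ) (l : List Bool) :
    (areaWordAux h l).IsChain fun a b => b ≤ a + 1 := by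
  induction l generalizing h with
  | nil => simp [areaWordAux]
  | cons b l ih =>
    cases b
    · exact ih (h - 1)
    · exact List.isChain_cons.mpr ⟨areaWordAux_head_le (h + 1) l, ih (h + 1)⟩

/-- The path starting at height `h` stays weakly above the horizontal axis. -/
def StaysNonneg : ℕ → List Bool → Prop
  | _, [] => True
  | h, true :: l => StaysNonneg (h + 1) l
  | h, false :: l => 0 < h ∧ StaysNonneg (h - 1) l

theorem areaWordAux_injective {h : ℕ} {l l' : List Bool} (hl : StaysNonneg h l)
    (hl' : StaysNonneg h l') (hlen : l.length = l'.length)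
    (heq : areaWordAux h l = areaWordAux h l') : l = l' := by
  induction l generalizing h l' with
  | nil => exact (List.length_eq_zero_iff.mp hlen.symm).symm
  | cons b l ih =>
    obtain _ | ⟨b', l'⟩ := l'
    · simp at hlen
    have hlen' : l.length = l'.length := by simpa using hlen
    cases b <;> cases b'
    · rw [ih hl.2 hl'.2 hlen' heq]
    · have := areaWordAux_head_le (h - 1) l h (by
        rw [areaWordAux, areaWordAux] at heq
        rw [heq]; simp)
      have := hl.1
      omega
    · have := areaWordAux_head_le (h - 1) l' h (by
        rw [areaWordAux, areaWordAux] at heq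
        rw [← heq]; simp)
      have := hl'.1
      omega
    · rw [ih hl hl' hlen' (List.cons.inj heq).2]

/-- The second path of the list of pairs of steps stays weakly below the first one, which starts
`d` steps above it, and they end at the same height. -/
def StaysBelow : ℕ → List (Bool × Bool) → Prop
  | d, [] => d = 0
  | d, p :: L => p.2.toNat ≤ d + p.1.toNat ∧ StaysBelow (d + p.1.toNat - p.2.toNat) L

/-- The sum of the height differences after each step of two lattice paths, the first one starting
`d` steps above the second. -/
def gapSum : ℕ → List (Bool × Bool) → ℕ
  | _, [] => 0
  | d, p :: L => d + p.1.toNat - p.2.toNat + gapSum (d + p.1.toNat - p.2.toNat) L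

/-- The interlacing of the two lattice paths, followed by a southeast step. -/
def interlace (L : List (Bool × Bool)) : List Bool :=
  (L.map fun p => [p.1, !p.2]).flatten ++ [false]

theorem interlace_cons (p : Bool × Bool) (L : List (Bool × Bool)) :
    interlace (p :: L) = p.1 :: (!p.2) :: interlace L := by
  simp [interlace]

theorem interlace_injective : Function.Injective interlace := by
  intro L L' h
  induction L generalizing L' with
  | nil =>
    cases L' with
    | nil => rfl
    | cons p L' => rw [interlace_cons] at h; simp [interlace] at h
  | cons p L ih =>
    cases L' with
    | nil => rw [interlace_cons] at h; simp [interlace] at h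
    | cons p' L' =>
      rw [interlace_cons, interlace_cons] at h
      simp only [List.cons.injEq, Bool.not_inj_iff] at h
      rw [ih h.2.2, Prod.ext h.1 h.2.1]

theorem staysNonneg_interlace {d : ℕ} {L : List (Bool × Bool)} (hL : StaysBelow d L) :
    StaysNonneg (2 * d + 1) (interlace L) := by
  induction L generalizing d with
  | nil => simp [interlace, StaysNonneg]
  | cons p L ih =>
    obtain ⟨r, g⟩ := p
    have h := ih hL.2
    have h1 := hL.1
    rw [interlace_cons]
    cases r <;> cases g <;> simp [StaysNonneg] at h h1 ⊢
    · exact h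
    · refine ⟨by omega, ?_⟩
      convert h using 1
      omega
    · exact h
    · exact h

theorem areaWordAux_interlace {d : ℕ} {L : List (Bool × Bool)} (hL : StaysBelow d L) :
    (areaWordAux (2 * d + 1) (interlace L)).length =
        L.countP (fun p => p.1) + L.countP (fun p => !p.2) ∧
      (areaWordAux (2 * d + 1) (interlace L)).countP (fun c => c % 2 = 0) =
        L.countP (fun p => !p.2) ∧
      ((areaWordAux (2 * d + 1) (interlace L)).map fun c => c / 2).sum + d.choose 2 =
        gapSum d L := by
  induction L generalizing d with
  | nil =>
    obtain rfl : d = 0 := hL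
    simp [interlace, areaWordAux, gapSum]
  | cons p L ih =>
    obtain ⟨r, g⟩ := p
    obtain ⟨h2, h3, h4⟩ := ih hL.2
    have h1 := hL.1
    rw [interlace_cons]
    cases r <;> cases g <;> simp [areaWordAux, gapSum] at h1 h2 h3 h4 ⊢
    · rw [h2, h3, ← h4]
      exact ⟨by omega, rfl, by omega⟩
    · obtain ⟨d, rfl⟩ : ∃ d', d = d' + 1 := ⟨d - 1, by omega⟩
      have h5 := Nat.choose_succ_succ' d 1
      simp only [Nat.choose_one_right, Nat.reduceAdd, Nat.add_sub_cancel] at h2 h3 h4 h5 ⊢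
      rw [show 2 * (d + 1) - 1 = 2 * d + 1 by omega, h2, h3, ← h4]
      exact ⟨rfl, rfl, by omega⟩
    · have h5 := Nat.choose_succ_succ' d 1
      simp only [Nat.choose_one_right, Nat.reduceAdd] at h5
      rw [show 2 * d + 1 + 1 + 1 = 2 * (d + 1) + 1 by omega,
        List.countP_cons_of_pos (by simp; omega), h2, h3, ← h4]
      exact ⟨by omega, by omega, by omega⟩
    · rw [h2, h3, ← h4]
      exact ⟨by omega, by omega, by omega⟩

theorem card_le_succ_true {N : ℕ} (p : Fin (N + 1) → Bool) (i : Fin N) :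
    (univ.filter fun j => j ≤ i.succ ∧ p j = true).card =
      (p 0).toNat + (univ.filter fun j => j ≤ i ∧ p (Fin.succ j) = true).card := by
  rw [Fin.card_filter_univ_succ']
  cases p 0 <;> simp

theorem card_le_zero_true {N : ℕ} (p : Fin (N + 1) → Bool) :
    (univ.filter fun j => j ≤ 0 ∧ p j = true).card = (p 0).toNat := by
  rw [Fin.card_filter_univ_succ']
  cases p 0 <;> simp

theorem card_true_succ {N : ℕ} (p : Fin (N + 1) → Bool) :
    (univ.filter fun j => p j = true).card =
      (p 0).toNat + (univ.filter fun j => p (Fin.succ j) = true).card := by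
  rw [Fin.card_filter_univ_succ']
  cases p 0 <;> simp

theorem staysBelow_ofFn {N : ℕ} {r g : Fin N → Bool} {d : ℕ}
    (hle : ∀ i, (univ.filter fun j => j ≤ i ∧ g j = true).card ≤
      d + (univ.filter fun j => j ≤ i ∧ r j = true).card)
    (htot : (univ.filter fun j => g j = true).card =
      d + (univ.filter fun j => r j = true).card) :
    StaysBelow d (List.ofFn fun i => (r i, g i)) ∧
      gapSum d (List.ofFn fun i => (r i, g i)) +
        ∑ i, (univ.filter fun j => j ≤ i ∧ g j = true).card =
        ∑ i, (d + (univ.filter fun j => j ≤ i ∧ r j = true).card) := by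
  induction N generalizing d with
  | zero => simpa [StaysBelow, gapSum] using htot.symm
  | succ N ih =>
    have h0 := hle 0
    rw [card_le_zero_true, card_le_zero_true] at h0
    rw [card_true_succ, card_true_succ r] at htot
    obtain ⟨h1, h2⟩ := ih (r := fun i => r i.succ) (g := fun i => g i.succ)
      (d := d + (r 0).toNat - (g 0).toNat) (fun i => by
        have := hle i.succ
        rw [card_le_succ_true, card_le_succ_true] at this
        omega) (by omega)
    rw [List.ofFn_succ]
    refine ⟨⟨h0, h1⟩, ?_⟩
    simp only [gapSum, Fin.sum_univ_succ, card_le_zero_true, card_le_succ_true, sum_add_distrib,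
      sum_const, card_univ, Fintype.card_fin, smul_eq_mul] at h2 ⊢
    obtain ⟨x, hx⟩ : ∃ x, x = d + (r 0).toNat - (g 0).toNat := ⟨_, rfl⟩
    have hx' : d + (r 0).toNat = x + (g 0).toNat := by omega
    rw [← hx] at h2 ⊢
    have hx'' : N * d + N * (r 0).toNat = N * x + N * (g 0).toNat := by
      rw [← mul_add, hx', mul_add]
    have := Nat.add_one_mul N d
    omega

namespace RedPoly

variable {m n : ℕ} (P : RedPoly m n)

/-- The list of pairs of simultaneous steps of the red and green paths. -/
def steps : List (Bool × Bool) := List.ofFn fun i => (P.red i, P.green i)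

theorem areaWord_eq : areaWord P = 0 :: areaWordAux (2 * 0 + 1) (interlace P.steps) := by
  simp [areaWord, interlaced, interlace, steps, areaWordAux, List.map_ofFn, Function.comp_def]

theorem staysBelow_steps : StaysBelow 0 P.steps :=
  (staysBelow_ofFn (by simpa using P.green_le_red)
    (by rw [P.red_count, P.green_count, zero_add])).1

theorem areaStat_add :
    areaStat P + ∑ i, (univ.filter fun j => j ≤ i ∧ P.green j = true).card =
      ∑ i, (univ.filter fun j => j ≤ i ∧ P.red j = true).card := by
  have h := (staysBelow_ofFn (d := 0) (by simpa using P.green_le_red)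
    (by rw [P.red_count, P.green_count, zero_add])).2
  have h1 := (areaWordAux_interlace P.staysBelow_steps).2.2
  simp only [zero_add] at h
  rw [← h, areaStat, areaWord_eq]
  simpa [steps] using h1

theorem countP_green_steps : P.steps.countP (fun p => !p.2) = m := by
  rw [steps, countP_ofFn_eq_card]
  simpa using P.card_green_false

theorem length_areaWord : (areaWord P).length = m + n + 1 := by
  have h : P.steps.countP (fun p => p.1) = n := by
    rw [steps, countP_ofFn_eq_card, P.red_count]
  rw [areaWord_eq, List.length_cons, (areaWordAux_interlace P.staysBelow_steps).1, h,
    P.countP_green_steps, add_comm n]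

theorem countP_areaWord : (areaWord P).countP (fun c => c % 2 = 0) = m + 1 := by
  rw [areaWord_eq, List.countP_cons, (areaWordAux_interlace P.staysBelow_steps).2.1,
    P.countP_green_steps]
  simp

theorem areaWord_injective : Function.Injective (areaWord : RedPoly m n → List ℕ) := by
  intro P P' h
  rw [areaWord_eq, areaWord_eq, List.cons.injEq] at h
  have h1 := interlace_injective (areaWordAux_injective
    (staysNonneg_interlace P.staysBelow_steps) (staysNonneg_interlace P'.staysBelow_steps)
    (by simp [interlace, steps, List.map_ofFn, Function.comp_def]) h.2)
  have h2 := List.ofFn_injective h1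
  obtain ⟨r, g, _, _, _⟩ := P
  obtain ⟨r', g', _, _, _⟩ := P'
  have hr : r = r' := funext fun i => congrArg Prod.fst (congrFun h2 i)
  have hg : g = g' := funext fun i => congrArg Prod.snd (congrFun h2 i)
  subst hr hg
  rfl

end RedPoly

instance {m n : ℕ} : Finite (RedPoly m n) := by
  refine Finite.of_injective (fun P => (P.red, P.green)) ?_
  rintro ⟨r, g, _, _, _⟩ ⟨r', g', _, _, _⟩ h
  obtain ⟨rfl, rfl⟩ := Prod.mk.inj h
  rfl

namespace RedPoly

variable {m n : ℕ} (Q : RedPoly n m)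

theorem length_areaWord_comm : (areaWord Q).length = m + n + 1 := by
  rw [length_areaWord, add_comm n]

theorem ofFn_getD_areaWord :
    (List.ofFn fun i : Fin (m + n + 1) => (areaWord Q).getD i 0) = areaWord Q := by
  apply List.ext_getElem
  · rw [List.length_ofFn, length_areaWord_comm]
  · intro i h1 h2
    rw [List.getElem_ofFn, List.getD_eq_getElem _ _ h2]

theorem isChain_areaWord : (areaWord Q).IsChain fun a b => b ≤ a + 1 :=
  isChain_areaWordAux 0 (interlaced Q)

/-- The area word of a polyomino, as a word whose letters are indexed by `Fin`. -/
def letterWord : LetterWord m n where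
  w i := (areaWord Q).getD i 0
  zero := by rw [areaWord_eq]; rfl
  step i j hij := by
    have hj : (i : ℕ) + 1 < (areaWord Q).length := by
      rw [length_areaWord_comm, hij]; exact j.isLt
    rw [← hij, List.getD_eq_getElem _ _ hj, List.getD_eq_getElem _ _ (Nat.lt_of_succ_lt hj)]
    exact List.isChain_iff_getElem.mp Q.isChain_areaWord i hj
  even_card := by
    have h := Q.countP_areaWord
    rw [← ofFn_getD_areaWord Q, countP_ofFn_eq_card] at h
    simpa only [decide_eq_true_eq] using h

theorem letterWord_injective :
    Function.Injective (letterWord : RedPoly n m → LetterWord m n) := by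
  intro Q Q' h
  apply areaWord_injective
  rw [← ofFn_getD_areaWord Q, ← ofFn_getD_areaWord Q']
  exact congrArg (fun W : LetterWord m n => List.ofFn W.w) h

/-- The polyomino whose red and green paths sort the letters of the area word. -/
def zeta : RedPoly m n := Q.letterWord.toRedPoly

theorem zeta_injective : Function.Injective (zeta : RedPoly n m → RedPoly m n) :=
  LetterWord.toRedPoly_injective.comp letterWord_injective

theorem zeta_surjective : Function.Surjective (zeta : RedPoly n m → RedPoly m n) :=
  (Finite.surjective_of_injective
    (zeta_injective.comp (zeta_injective (m := n) (n := m)))).of_comp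

theorem areaStat_zeta : areaStat Q.zeta = dinvStat Q := by
  have h1 := Q.zeta.areaStat_add
  have h2 := Q.letterWord.sum_card_red
  rw [LetterWord.sum_invCount] at h2
  have h3 : areaStat Q.zeta = (univ.filter fun p : Fin (m + n + 1) × Fin (m + n + 1) =>
      p.1 < p.2 ∧ Q.letterWord.w p.1 = Q.letterWord.w p.2 + 1).card := by
    rw [zeta] at h1 ⊢
    omega
  rw [h3, dinvStat, length_areaWord_comm]
  refine card_bij (fun p _ => ((p.1 : ℕ), (p.2 : ℕ))) ?_ ?_ ?_
  · intro p hp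
    exact mem_filter.mpr ⟨mem_product.mpr ⟨mem_range.mpr p.1.isLt, mem_range.mpr p.2.isLt⟩,
      (mem_filter.mp hp).2⟩
  · intro p _ p' _ h
    rw [Prod.mk.injEq] at h
    exact Prod.ext (Fin.ext h.1) (Fin.ext h.2)
  · rintro ⟨a, b⟩ h
    simp only [mem_filter, mem_product, mem_range] at h
    exact ⟨(⟨a, h.1.1⟩, ⟨b, h.1.2⟩), by simpa [letterWord] using h.2, rfl⟩

theorem zeroLabelCount_zeta : zeroLabelCount Q.zeta + 1 = (areaWord Q).count 0 := by
  rw [zeta, LetterWord.zeroLabelCount_toRedPoly, ← ofFn_getD_areaWord Q, List.count,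
    countP_ofFn_eq_card]
  simp [letterWord]

/-- The position in the area word of the letter giving rise to the step `j` of the red path
of `Q.zeta`. -/
def redSource (j : Fin (m + n)) : Fin (m + n + 1) := (sortPos Q.letterWord.redKey).symm j.succ

theorem redSource_injective : Function.Injective fun j => (Q.redSource j : ℕ) :=
  Fin.val_injective.comp sortPos_symm_succ_injective

theorem exists_redSource_eq {d : ℕ} (h0 : 0 < d) (hd : d < m + n + 1) :
    ∃ j, (Q.redSource j : ℕ) = d := by
  obtain ⟨j, hj⟩ := exists_sortPos_eq_succ Q.letterWord.redKey_zero
    (e := (⟨d, hd⟩ : Fin (m + n + 1))) (by rw [Ne, Fin.ext_iff]; exact h0.ne')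
  exact ⟨j, by rw [redSource, ← hj, Equiv.symm_apply_apply]⟩

theorem isRedValley_zeta_iff (j : Fin (m + n)) :
    IsRedValley Q.zeta j ↔ IsRise (areaWord Q) (Q.redSource j) := by
  rw [zeta, LetterWord.isRedValley_toRedPoly_iff, IsRise, length_areaWord_comm]
  change (∃ i : Fin (m + n + 1), (i : ℕ) + 1 = Q.redSource j ∧ (areaWord Q).getD i 0 % 2 = 1 ∧
    (areaWord Q).getD (Q.redSource j) 0 = (areaWord Q).getD i 0 + 1) ↔ _
  constructor
  · rintro ⟨i, h1, h2, h3⟩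
    rw [show (Q.redSource j : ℕ) - 1 = i by omega]
    exact ⟨by omega, (Q.redSource j).isLt, h2, h3⟩
  · rintro ⟨h1, h2, h3, h4⟩
    exact ⟨⟨(Q.redSource j : ℕ) - 1, by omega⟩, Nat.sub_add_cancel h1, h3, h4⟩

end RedPoly

namespace RiseDecorated

variable {m n k : ℕ} (Q : RiseDecorated n m k)

theorem exists_redSource_eq_of_mem {d : ℕ} (hd : d ∈ Q.marks) :
    ∃ j, (Q.poly.redSource j : ℕ) = d := by
  obtain ⟨h0, h1, -⟩ := Q.marks_rise d hd
  rw [RedPoly.length_areaWord_comm] at h1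
  exact Q.poly.exists_redSource_eq h0 h1

theorem image_redSource :
    (univ.filter fun j => (Q.poly.redSource j : ℕ) ∈ Q.marks).image
      (fun j => (Q.poly.redSource j : ℕ)) = Q.marks := by
  ext d
  simp only [mem_image, mem_filter, mem_univ, true_and]
  constructor
  · rintro ⟨j, hj, rfl⟩
    exact hj
  · intro hd
    obtain ⟨j, rfl⟩ := Q.exists_redSource_eq_of_mem hd
    exact ⟨j, hd, rfl⟩

/-- The image under `RedPoly.zeta` of a polyomino with decorated rises, with the corresponding red
valleys decorated. -/
def toValleyDecorated : ValleyDecorated m n k where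
  poly := Q.poly.zeta
  marks := univ.filter fun j => (Q.poly.redSource j : ℕ) ∈ Q.marks
  marks_card := by
    have h := congrArg card Q.image_redSource
    rwa [card_image_of_injective _ Q.poly.redSource_injective, Q.marks_card] at h
  marks_valley j hj :=
    (Q.poly.isRedValley_zeta_iff j).mpr (Q.marks_rise _ (mem_filter.mp hj).2)

theorem toValleyDecorated_bijective :
    Function.Bijective (toValleyDecorated : RiseDecorated n m k → ValleyDecorated m n k) := by
  constructor
  · intro Q Q' h
    have h1 : Q.poly = Q'.poly :=
      RedPoly.zeta_injective (congrArg ValleyDecorated.poly h)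
    have h2 : Q.toValleyDecorated.marks = Q'.toValleyDecorated.marks := by rw [h]
    have h3 : Q.marks = Q'.marks := by
      rw [← Q.image_redSource, ← Q'.image_redSource]
      change Q.toValleyDecorated.marks.image _ = Q'.toValleyDecorated.marks.image _
      rw [h2, h1]
    obtain ⟨_, _, _, _⟩ := Q
    obtain ⟨_, _, _, _⟩ := Q'
    subst h1 h3
    rfl
  · rintro ⟨P, M, hM, hv⟩
    obtain ⟨Q, rfl⟩ := RedPoly.zeta_surjective P
    refine ⟨⟨Q, M.image fun j => (Q.redSource j : ℕ), ?_, ?_⟩, ?_⟩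
    · rw [card_image_of_injective _ Q.redSource_injective, hM]
    · intro d hd
      obtain ⟨j, hj, rfl⟩ := mem_image.mp hd
      exact (Q.isRedValley_zeta_iff j).mp (hv j hj)
    · simp only [toValleyDecorated, ValleyDecorated.mk.injEq, true_and]
      ext j
      simp only [mem_filter, mem_univ, true_and]
      exact Q.redSource_injective.mem_finset_image

theorem uBounce_toValleyDecorated : uBounce Q.toValleyDecorated = uArea Q := by
  have hmem : ∀ i, i ∈ Q.toValleyDecorated.marks.image Q.poly.redSource ↔ (i : ℕ) ∈ Q.marks := by
    intro i
    constructor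
    · intro hi
      obtain ⟨j, hj, rfl⟩ := mem_image.mp hi
      exact (mem_filter.mp hj).2
    · intro hi
      obtain ⟨j, hj⟩ := Q.exists_redSource_eq_of_mem hi
      rw [← Fin.ext hj]
      exact mem_image_of_mem _ (mem_filter.mpr ⟨mem_univ _, hj ▸ hi⟩)
  have h1 := Q.poly.letterWord.sum_vertLabel_sdiff (M := Q.toValleyDecorated.marks)
    fun j hj => (Q.toValleyDecorated.marks_valley j hj).1
  have h2 : uArea Q = ∑ i ∈ univ.filter fun i : Fin (m + n + 1) => (i : ℕ) ∉ Q.marks,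
      Q.poly.letterWord.w i / 2 := by
    rw [uArea, RedPoly.length_areaWord_comm, ← filter_notMem_eq_sdiff, sum_filter, sum_filter,
      sum_range]
    rfl
  have h3 : ∀ i : Fin (m + n + 1), (i : ℕ) ∈ Q.marks → Q.poly.letterWord.w i % 2 = 0 := by
    intro i hi
    obtain ⟨-, -, h4, h5⟩ := Q.marks_rise i hi
    change (areaWord Q.poly).getD i 0 % 2 = 0
    omega
  rw [h2, uBounce]
  refine (congrArg₂ (· + ·) h1 Q.poly.letterWord.sum_horLabel).trans ?_
  change ∑ i with i ∉ Q.toValleyDecorated.marks.image Q.poly.redSource ∧ _, _ + _ = _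
  simp only [hmem]
  rw [← sum_filter_add_sum_filter_not (univ.filter fun i : Fin (m + n + 1) => (i : ℕ) ∉ Q.marks)
    fun i => Q.poly.letterWord.w i % 2 = 0, filter_filter, filter_filter]
  congr 2
  ext i
  simp only [mem_filter, mem_univ, true_and]
  have := h3 i
  constructor
  · exact fun h => ⟨fun hi => by have := h3 i hi; omega, by omega⟩
  · exact fun h => by omega

end RiseDecorated

theorem stmt3 (m n k s : ℕ) (hm : 1 ≤ m) (hn : 1 ≤ n) (hs : 1 ≤ s) (hsn : s ≤ n + 1) :
    RPbullet m n s k = RPstar n m s k ∧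
    (∑ᶠ P : ValleyDecorated m n k, Xq ^ areaStat P.poly * Xt ^ uBounce P) =
      ∑ᶠ Q : RiseDecorated n m k, Xq ^ dinvStat Q.poly * Xt ^ uArea Q := by
  have h : ∀ Q : RiseDecorated n m k, areaStat Q.toValleyDecorated.poly = dinvStat Q.poly :=
    fun Q => Q.poly.areaStat_zeta
  have h' : ∀ Q : RiseDecorated n m k,
      zeroLabelCount Q.toValleyDecorated.poly + 1 = (areaWord Q.poly).count 0 :=
    fun Q => Q.poly.zeroLabelCount_zeta
  refine ⟨(finsum_eq_of_bijective _ RiseDecorated.toValleyDecorated_bijective fun Q => ?_).symm,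
    (finsum_eq_of_bijective _ RiseDecorated.toValleyDecorated_bijective fun Q => ?_).symm⟩
  · rw [h, h', Q.uBounce_toValleyDecorated]
  · rw [h, Q.uBounce_toValleyDecorated]
end

section
/- For all m ≥ 0 and n ≥ 1: (i) RPqt•(m, n; n+1; 0) = [m+n choose m]_q; (ii) for every k ≥ 1 the set RP(m, n; n+1)^{•k} is empty; and (iii) for all k ≥ 0 and 1 ≤ s ≤ n+1, RPqt•(0, n; s; k) = 1 if k = 0 and s = n+1, and RPqt•(0, n; s; k) = 0 otherwise. -/
open Finset

/-! ### Words and their inversions -/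

/-- The number of pairs `i < j` such that the word has `false` at `i` and `true` at `j`. -/
def inversions : List Bool → ℕ
  | [] => 0
  | true :: w => inversions w
  | false :: w => w.count true + inversions w

theorem inversions_append_singleton (w : List Bool) (b : Bool) :
    inversions (w ++ [b]) = inversions w + if b then w.count false else 0 := by
  induction w with
  | nil => cases b <;> simp [inversions]
  | cons c w ih => cases c <;> cases b <;> simp [inversions, ih]; omega

theorem sum_fin_succ_snoc {M α : Type*} [AddCommMonoid M] [Fintype α] {N : ℕ}
    (F : (Fin (N + 1) → α) → M) :
    ∑ g, F g = ∑ b : α, ∑ g : Fin N → α, F (Fin.snoc g b) := by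
  rw [← (Fin.snocEquiv fun _ => α).sum_comp F, Fintype.sum_prod_type]
  rfl

theorem ofFn_snoc {α : Type*} {N : ℕ} (g : Fin N → α) (b : α) :
    List.ofFn (Fin.snoc g b : Fin (N + 1) → α) = List.ofFn g ++ [b] := by
  rw [List.ofFn_succ']
  simp

theorem sum_pow_inversions {R : Type*} [CommSemiring R] (x : R) (N b : ℕ) :
    ∑ g : Fin N → Bool, (if (List.ofFn g).count false = b then x ^ inversions (List.ofFn g) else 0)
      = qbinom x N b := by
  induction N generalizing b with
  | zero => cases b <;> simp [qbinom, inversions]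
  | succ N ih =>
    rw [sum_fin_succ_snoc, Fintype.sum_bool]
    simp only [ofFn_snoc, inversions_append_singleton]
    cases b with
    | zero =>
      have h := ih 0
      simp only [qbinom] at h ⊢
      simp only [List.count_append, List.count_singleton]
      refine Eq.trans (congrArg₂ (· + ·) (Finset.sum_congr rfl fun g _ => ?_)
        (Finset.sum_eq_zero fun g _ => by simp)) ((add_zero _).trans h)
      by_cases hg : (List.ofFn g).count false = 0 <;> simp [hg]
    | succ b =>
      simp only [qbinom, ← ih, Finset.mul_sum]
      rw [add_comm]
      congr 1
      · simp
      · refine Finset.sum_congr rfl fun g _ => ?_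
        by_cases hg : (List.ofFn g).count false = b + 1 <;> simp [hg, pow_add, mul_comm]

theorem count_ofFn_eq_card {α : Type*} [DecidableEq α] {N : ℕ} (g : Fin N → α) (a : α) :
    (List.ofFn g).count a = #{i | g i = a} := by
  have := Fin.card_filter_univ_eq_vector_get_eq_count a (List.Vector.ofFn g)
  simp only [List.Vector.get_ofFn, List.Vector.toList_ofFn] at this
  exact this.symm

/-! ### The area when the red path starts with all its north steps -/

theorem sum_areaWordAux_eq_inversions (g : List Bool) (a b d : ℕ) (hl : g.length = a + b)
    (hc : g.count true = a + d) :
    ((areaWordAux (2 * d + 1) ((List.zipWith (fun r s => [r, !s])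
      (List.replicate a true ++ List.replicate b false) g).flatten ++ [false])).map
        fun c => c / 2).sum = inversions g + a * d := by
  induction g generalizing a b d with
  | nil =>
    have : a = 0 := by simp at hl; omega
    subst this
    simp [areaWordAux, inversions]
  | cons s g ih =>
    cases a with
    | zero =>
      obtain _ | b := b
      · simp at hl
      have hl' : g.length = 0 + b := by simp at hl; omega
      cases s
      · have := ih 0 b d hl' (by simpa using hc)
        have hc' : g.count true = d := by simpa using hc
        simp_all [areaWordAux, inversions, List.replicate_succ]
      · obtain _ | d := d
        · simp at hc
        have := ih 0 b d hl' (by simp at hc; omega)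
        simp_all [areaWordAux, inversions, List.replicate_succ, mul_add]
    | succ a =>
      have hl' : g.length = a + b := by simp at hl; omega
      cases s
      · have hc' : g.count true = a + (d + 1) := by simp at hc; omega
        have := ih a b (d + 1) hl' hc'
        have e : (2 * d + 1) / 2 = d := by omega
        have e' : (2 * d + 1 + 1) / 2 = d + 1 := by omega
        simp only [List.replicate_succ, List.cons_append, List.zipWith_cons_cons,
          List.flatten_cons, areaWordAux, Bool.not_false, List.nil_append, List.map_cons,
          List.sum_cons, inversions, hc', e, e']
        rw [show 2 * d + 1 + 1 + 1 = 2 * (d + 1) + 1 by ring, this]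
        ring
      · have := ih a b d hl' (by simp at hc; omega)
        have e : (2 * d + 1) / 2 = d := by omega
        simp only [List.replicate_succ, List.cons_append, List.zipWith_cons_cons,
          List.flatten_cons, areaWordAux, Bool.not_true, List.nil_append, List.map_cons,
          List.sum_cons, inversions, e, Nat.add_sub_cancel]
        rw [this]
        ring

/-- The path consisting of `n` north steps followed by `m` east steps. -/
def northFirst (m n : ℕ) (i : Fin (m + n)) : Bool := decide ((i : ℕ) < n)

theorem northFirst_eq_true_iff {m n : ℕ} {i : Fin (m + n)} :
    northFirst m n i = true ↔ (i : ℕ) < n := by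
  simp [northFirst]

theorem northFirst_eq_false_iff {m n : ℕ} {i : Fin (m + n)} :
    northFirst m n i = false ↔ n ≤ (i : ℕ) := by
  simp [northFirst]

theorem ofFn_northFirst (m n : ℕ) :
    List.ofFn (northFirst m n) =
      List.replicate n true ++ List.replicate m false := by
  refine List.ext_getElem (by simp [add_comm]) fun i _ _ => ?_
  by_cases h : i < n <;> simp [northFirst, List.getElem_append, h]

theorem areaStat_eq_inversions {m n : ℕ} (P : RedPoly m n)
    (hP : P.red = northFirst m n) :
    areaStat P = inversions (List.ofFn P.green) := by
  have hz : (List.ofFn fun i => [P.red i, !P.green i]) =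
      List.zipWith (fun r s => [r, !s])
        (List.replicate n true ++ List.replicate m false) (List.ofFn P.green) := by
    rw [← ofFn_northFirst, ← hP]
    exact List.ext_getElem (by simp) (by simp)
  have h := sum_areaWordAux_eq_inversions (List.ofFn P.green) n m 0 (by simp [add_comm])
    (by rw [count_ofFn_eq_card, P.green_count, add_zero])
  simpa [areaStat, areaWord, interlaced, areaWordAux, hz] using h

/-! ### Polyominoes all of whose vertical bounce steps are labelled `0` -/

section FullHeight

variable {m n : ℕ}

theorem heightAt_of_red_eq (P : RedPoly m n) (hP : P.red = northFirst m n) (x : ℕ) :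
    heightAt P.red x = n := by
  have h : ∀ j, P.red j = true → falsesBefore P.red j = 0 := by
    intro j hj
    rw [falsesBefore, Finset.card_eq_zero, Finset.filter_eq_empty_iff]
    rintro l - ⟨hl, hf⟩
    simp only [hP, northFirst_eq_true_iff, northFirst_eq_false_iff] at hj hf
    omega
  rw [heightAt]
  refine (congrArg Finset.card ?_).trans P.red_count
  ext j
  simp only [Finset.mem_filter, Finset.mem_univ, true_and, and_iff_left_iff_imp]
  intro hj
  simp [h j hj]

theorem red_eq_of_le_heightAt (P : RedPoly m n) (h : n ≤ heightAt P.red 0) :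
    P.red = northFirst m n := by
  have hsub : (univ.filter fun j => P.red j = true ∧ falsesBefore P.red j ≤ 0) =
      univ.filter fun j => P.red j = true :=
    Finset.eq_of_subset_of_card_le (fun j => by simp; tauto) (by rw [P.red_count]; exact h)
  funext j
  have key := Fin.lt_card_filter_univ_iff_apply_of_imp (j := j) (fun i => P.red i = true) ?_
  · rw [P.red_count] at key
    rw [Bool.eq_iff_iff, northFirst_eq_true_iff, key]
  · intro i l hli hi
    have hi' : i ∈ univ.filter fun j => P.red j = true ∧ falsesBefore P.red j ≤ 0 := by
      rw [hsub]; simpa using hi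
    simp only [Finset.mem_filter, Finset.mem_univ, true_and, Nat.le_zero, falsesBefore,
      Finset.card_eq_zero, Finset.filter_eq_empty_iff, not_and, Bool.not_eq_false] at hi'
    rcases hli.lt_or_eq with hlt | rfl
    · exact hi'.2 trivial hlt
    · exact hi

theorem vertLabel_eq_zero_of_red_eq (P : RedPoly m n)
    (hP : P.red = northFirst m n) {y : ℕ} (hy : y < n) : vertLabel P y = 0 := by
  rw [vertLabel, Finset.card_eq_zero, Finset.filter_eq_empty_iff]
  intro k _
  simp only [bouncePt, heightAt_of_red_eq P hP]
  omega

theorem zeroLabelCount_eq_iff (P : RedPoly m n) :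
    zeroLabelCount P = n ↔ P.red = northFirst m n := by
  constructor
  · intro h
    refine red_eq_of_le_heightAt P ?_
    by_contra! hlt
    have hall := (Finset.card_filter_eq_iff (s := Finset.range n)
      (p := fun y => vertLabel P y = 0)).mp (by simpa [zeroLabelCount] using h)
    have := hall (n - 1) (by simp; omega)
    rw [vertLabel, Finset.card_eq_zero, Finset.filter_eq_empty_iff] at this
    refine this (x := 0) (by simp; omega) ?_
    simp only [bouncePt]
    omega
  · intro hP
    rw [zeroLabelCount, Finset.filter_true_of_mem, Finset.card_range]
    intro y hy
    exact vertLabel_eq_zero_of_red_eq P hP (Finset.mem_range.mp hy)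

theorem card_eq_false (g : Fin (m + n) → Bool) (hg : #{i | g i = true} = n) :
    #{i | g i = false} = m := by
  have := Finset.card_filter_add_card_filter_not (s := (univ : Finset (Fin (m + n))))
    (fun i => g i = true)
  simp only [hg, Bool.not_eq_true, Finset.card_univ, Fintype.card_fin] at this
  omega

theorem horLabel_eq_zero_of_red_eq (P : RedPoly m n)
    (hP : P.red = northFirst m n) {x : ℕ} (hx : x < m) : horLabel P x = 0 := by
  have hxc : xcoordAt P.green n = m := by
    rw [xcoordAt]
    refine (congrArg Finset.card ?_).trans (card_eq_false P.green P.green_count)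
    ext j
    simp only [Finset.mem_filter, Finset.mem_univ, true_and, and_iff_left_iff_imp]
    intro _
    exact (Finset.card_le_card fun l => by simp).trans P.green_count.le
  rw [horLabel, Finset.card_eq_zero, Finset.filter_eq_empty_iff]
  intro k _
  simp only [bouncePt, heightAt_of_red_eq P hP, hxc]
  omega

theorem not_isRedValley_of_red_eq (P : RedPoly m n)
    (hP : P.red = northFirst m n) (j : Fin (m + n)) : ¬ IsRedValley P j := by
  rintro ⟨hj, i, hij, hi⟩
  simp only [hP, northFirst_eq_true_iff, northFirst_eq_false_iff] at hj hi
  omega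

theorem uBounce_eq_zero_of_red_eq {k : ℕ} (Q : ValleyDecorated m n k)
    (hQ : Q.poly.red = northFirst m n) : uBounce Q = 0 := by
  rw [uBounce, Nat.add_eq_zero_iff]
  constructor
  · refine Finset.sum_eq_zero fun y hy => vertLabel_eq_zero_of_red_eq _ hQ ?_
    exact Finset.mem_range.mp (Finset.mem_sdiff.mp hy).1
  · exact Finset.sum_eq_zero fun x hx =>
      horLabel_eq_zero_of_red_eq _ hQ (Finset.mem_range.mp hx)

/-- The polyomino with a given green path whose red path starts with all its north steps. -/
def topRedPoly (g : Fin (m + n) → Bool) (hg : #{i | g i = true} = n) : RedPoly m n where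
  red := northFirst m n
  green := g
  red_count := by simp [northFirst_eq_true_iff, Fin.card_filter_val_lt]
  green_count := hg
  green_le_red i := by
    by_cases hi : (i : ℕ) < n
    · refine Finset.card_le_card fun j => ?_
      simp only [Finset.mem_filter, Finset.mem_univ, true_and, northFirst_eq_true_iff]
      rintro ⟨hj, -⟩
      exact ⟨hj, by omega⟩
    · calc #{j | j ≤ i ∧ g j = true} ≤ #{j | g j = true} :=
            Finset.card_le_card fun j => by simp
        _ = #{j : Fin (m + n) | (j : ℕ) < n} := by simp [hg, Fin.card_filter_val_lt]
        _ ≤ _ := Finset.card_le_card fun j => by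
            simp only [Finset.mem_filter, Finset.mem_univ, true_and, northFirst_eq_true_iff]
            exact fun hj => ⟨by omega, hj⟩

theorem bijOn_green (m n : ℕ) :
    Set.BijOn (fun Q : ValleyDecorated m n 0 => Q.poly.green)
      {Q | zeroLabelCount Q.poly + 1 = n + 1}
      (univ.filter fun g : Fin (m + n) → Bool => (List.ofFn g).count false = m : Finset _) := by
  refine ⟨?_, ?_, ?_⟩
  · intro Q _
    simp [count_ofFn_eq_card, card_eq_false _ Q.poly.green_count]
  · rintro ⟨P, M, hM, _⟩ hQ ⟨P', M', hM', _⟩ hQ' hg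
    simp only [Set.mem_ofPred_eq, Nat.add_right_cancel_iff, zeroLabelCount_eq_iff] at hQ hQ'
    rw [Finset.card_eq_zero] at hM hM'
    subst hM hM'
    obtain ⟨r, g, _, _, _⟩ := P
    obtain ⟨r', g', _, _, _⟩ := P'
    dsimp only at hQ hQ' hg
    subst hQ hQ' hg
    rfl
  · intro g hg
    simp only [Finset.coe_filter, Finset.mem_univ, true_and, Set.mem_ofPred_eq,
      count_ofFn_eq_card] at hg
    have hg' : #{i | g i = true} = n := by
      have := Finset.card_filter_add_card_filter_not (s := (univ : Finset (Fin (m + n))))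
        (fun i => g i = true)
      simp only [hg, Bool.not_eq_true, Finset.card_univ, Fintype.card_fin] at this
      omega
    refine ⟨⟨topRedPoly g hg', ∅, rfl, by simp⟩, ?_, rfl⟩
    simp only [Set.mem_ofPred_eq, Nat.add_right_cancel_iff, zeroLabelCount_eq_iff]
    rfl

theorem RPbullet_succ_zero (m n : ℕ) : RPbullet m n (n + 1) 0 = qbinom Xq (m + n) m := by
  have h : ∀ Q : ValleyDecorated m n 0,
      (if zeroLabelCount Q.poly + 1 = n + 1 then Xq ^ areaStat Q.poly * Xt ^ uBounce Q else 0) =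
        ∑ᶠ _ : Q ∈ {Q : ValleyDecorated m n 0 | zeroLabelCount Q.poly + 1 = n + 1},
          Xq ^ areaStat Q.poly * Xt ^ uBounce Q := by
    intro Q
    rw [← finsum_eq_if]
    rfl
  rw [RPbullet, finsum_congr h, finsum_mem_eq_of_bijOn
    (g := fun g => Xq ^ inversions (List.ofFn g)) _ (bijOn_green m n),
    finsum_mem_coe_finset, Finset.sum_filter, sum_pow_inversions]
  intro Q hQ
  simp only [Set.mem_ofPred_eq, Nat.add_right_cancel_iff, zeroLabelCount_eq_iff] at hQ
  rw [uBounce_eq_zero_of_red_eq Q hQ, areaStat_eq_inversions _ hQ, pow_zero, mul_one]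

theorem zeroLabelCount_ne_of_pos {k : ℕ} (hk : 1 ≤ k) (Q : ValleyDecorated m n k) :
    zeroLabelCount Q.poly ≠ n := by
  rw [Ne, zeroLabelCount_eq_iff]
  intro hQ
  obtain ⟨j, hj⟩ := Finset.card_pos.mp (Q.marks_card.symm ▸ hk)
  exact not_isRedValley_of_red_eq _ hQ j (Q.marks_valley j hj)

theorem zeroLabelCount_of_width_zero (P : RedPoly 0 n) : zeroLabelCount P = n := by
  rw [zeroLabelCount_eq_iff]
  funext i
  have := (Finset.card_filter_eq_iff (s := (univ : Finset (Fin (0 + n))))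
    (p := fun i => P.red i = true)).mp (by simp [P.red_count]) i (Finset.mem_univ i)
  rw [this, eq_comm, northFirst_eq_true_iff]
  omega

end FullHeight

theorem stmt5 (m n : ℕ) (hn : 1 ≤ n) :
    RPbullet m n (n + 1) 0 = qbinom Xq (m + n) m ∧
    (∀ k, 1 ≤ k → ∀ Q : ValleyDecorated m n k, zeroLabelCount Q.poly + 1 ≠ n + 1) ∧
    (∀ k s, 1 ≤ s → s ≤ n + 1 →
      RPbullet 0 n s k = if k = 0 ∧ s = n + 1 then 1 else 0) := by
  refine ⟨RPbullet_succ_zero m n, fun k hk Q h =>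
    zeroLabelCount_ne_of_pos hk Q (Nat.add_right_cancel h), fun k s _ _ => ?_⟩
  split_ifs with h
  · obtain ⟨rfl, rfl⟩ := h
    rw [RPbullet_succ_zero]
    cases n <;> simp [qbinom]
  · rw [RPbullet]
    refine finsum_eq_zero_of_forall_eq_zero fun Q => if_neg fun hs => h ⟨?_, ?_⟩
    · by_contra hk
      exact zeroLabelCount_ne_of_pos (Nat.one_le_iff_ne_zero.mpr hk) Q
        (zeroLabelCount_of_width_zero Q.poly)
    · rw [← hs, zeroLabelCount_of_width_zero]
end

section
/- For all m, n ≥ 1 and k ≥ 0 there is a bijection between RP(m,n)^{★k} and the set of two-cars parking functions of size m+n with n labels equal to 1, m labels equal to 2, and k decorated rises, which preserves the bistatistic (dinv, underlined-area). Explicitly, given such a parking function, putting a bar on each letter of its area word whose attached label is 1 and prepending an unbarred 0 yields the area word of the corresponding m×n reduced polyomino, with decorated rises corresponding to decorated rises. -/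
open Finset

/-- Reading a sequence of northeast (`true`) / southeast (`false`) steps from height `h`
never goes below the axis and ends on it. -/
def IsDyckFrom : ℕ → List Bool → Prop
  | h, [] => h = 0
  | h, true :: L => IsDyckFrom (h + 1) L
  | h, false :: L => 0 < h ∧ IsDyckFrom (h - 1) L

/-- The word `w` is the sequence of starting heights of the northeast steps of some path
starting at height `h`. -/
def IsAreaWordFrom : ℕ → List ℕ → Prop
  | _, [] => True
  | h, c :: w => c ≤ h ∧ IsAreaWordFrom (c + 1) w

/-- The path starting at height `h`, ending on the axis, with area word `w`. -/
def pathOfWord : ℕ → List ℕ → List Bool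
  | h, [] => List.replicate h false
  | h, c :: w => List.replicate (h - c) false ++ true :: pathOfWord (c + 1) w

/-- The steps of the interlaced path contributed by a list of pairs of red and green steps. -/
def interlacePairs (ps : List (Bool × Bool)) : List Bool :=
  (ps.map fun p => [p.1, !p.2]).flatten

@[simp] lemma interlacePairs_nil : interlacePairs [] = [] := rfl

@[simp] lemma interlacePairs_cons (p : Bool × Bool) (ps : List (Bool × Bool)) :
    interlacePairs (p :: ps) = p.1 :: (!p.2) :: interlacePairs ps := rfl

lemma isDyckFrom_replicate_append (d h : ℕ) (L : List Bool) :
    IsDyckFrom (d + h) (List.replicate d false ++ L) ↔ IsDyckFrom h L := by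
  induction d with
  | zero => simp
  | succ d ih =>
    rw [List.replicate_succ, List.cons_append, IsDyckFrom,
      show d + 1 + h - 1 = d + h by omega, ih]
    simp

lemma areaWordAux_replicate_append (d h : ℕ) (L : List Bool) :
    areaWordAux (d + h) (List.replicate d false ++ L) = areaWordAux h L := by
  induction d with
  | zero => simp
  | succ d ih =>
    rw [List.replicate_succ, List.cons_append, areaWordAux,
      show d + 1 + h - 1 = d + h by omega, ih]

lemma isDyckFrom_pathOfWord {h : ℕ} {w : List ℕ} (hw : IsAreaWordFrom h w) :
    IsDyckFrom h (pathOfWord h w) := by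
  induction w generalizing h with
  | nil => simpa [pathOfWord, IsDyckFrom] using isDyckFrom_replicate_append h 0 []
  | cons c w ih =>
    obtain ⟨hc, hw⟩ := hw
    have := isDyckFrom_replicate_append (h - c) c (true :: pathOfWord (c + 1) w)
    rw [Nat.sub_add_cancel hc] at this
    exact this.2 (ih hw)

lemma areaWordAux_pathOfWord {h : ℕ} {w : List ℕ} (hw : IsAreaWordFrom h w) :
    areaWordAux h (pathOfWord h w) = w := by
  induction w generalizing h with
  | nil => simpa [pathOfWord, areaWordAux] using areaWordAux_replicate_append h 0 []
  | cons c w ih =>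
    obtain ⟨hc, hw⟩ := hw
    have := areaWordAux_replicate_append (h - c) c (true :: pathOfWord (c + 1) w)
    rw [Nat.sub_add_cancel hc] at this
    rw [pathOfWord, this, areaWordAux, ih hw]

lemma isAreaWordFrom_mono {h h' : ℕ} (hh : h ≤ h') {w : List ℕ}
    (hw : IsAreaWordFrom h w) : IsAreaWordFrom h' w := by
  cases w with
  | nil => trivial
  | cons c w => exact ⟨hw.1.trans hh, hw.2⟩

lemma isAreaWordFrom_areaWordAux (h : ℕ) (L : List Bool) :
    IsAreaWordFrom h (areaWordAux h L) := by
  induction L generalizing h with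
  | nil => trivial
  | cons b L ih =>
    cases b with
    | true => exact ⟨le_rfl, ih _⟩
    | false => exact isAreaWordFrom_mono (Nat.sub_le h 1) (ih _)

lemma pathOfWord_succ {h : ℕ} {w : List ℕ} (hw : IsAreaWordFrom h w) :
    pathOfWord (h + 1) w = false :: pathOfWord h w := by
  cases w with
  | nil => rfl
  | cons c w =>
    rw [pathOfWord, pathOfWord, Nat.succ_sub hw.1, List.replicate_succ, List.cons_append]

lemma pathOfWord_areaWordAux {h : ℕ} {L : List Bool} (hL : IsDyckFrom h L) :
    pathOfWord h (areaWordAux h L) = L := by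
  induction L generalizing h with
  | nil =>
    obtain rfl : h = 0 := hL
    rfl
  | cons b L ih =>
    cases b with
    | true => simp [areaWordAux, pathOfWord, ih hL]
    | false =>
      obtain ⟨hpos, hL⟩ := hL
      obtain ⟨h, rfl⟩ := Nat.exists_eq_add_of_lt hpos
      simp only [zero_add, Nat.add_sub_cancel, areaWordAux] at hL ⊢
      rw [pathOfWord_succ (isAreaWordFrom_areaWordAux _ _), ih hL]

lemma length_eq_of_isDyckFrom {h : ℕ} {L : List Bool} (hL : IsDyckFrom h L) :
    L.length = 2 * (areaWordAux h L).length + h := by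
  induction L generalizing h with
  | nil =>
    obtain rfl : h = 0 := hL
    rfl
  | cons b L ih =>
    cases b with
    | true =>
      have := ih hL
      simp only [areaWordAux, List.length_cons]
      omega
    | false =>
      have := ih hL.2
      have := hL.1
      simp only [areaWordAux, List.length_cons]
      omega

lemma exists_eq_append_false_of_isDyckFrom {h : ℕ} {L : List Bool} (hL : IsDyckFrom h L)
    (hne : L ≠ []) : ∃ L', L = L' ++ [false] := by
  induction L generalizing h with
  | nil => exact absurd rfl hne
  | cons b L ih =>
    rcases eq_or_ne L [] with rfl | hL'
    · cases b with
      | true => exact absurd hL (Nat.succ_ne_zero h)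
      | false => exact ⟨[], rfl⟩
    · have : ∃ h', IsDyckFrom h' L := by
        cases b with
        | true => exact ⟨_, hL⟩
        | false => exact ⟨_, hL.2⟩
      obtain ⟨h', hh'⟩ := this
      obtain ⟨L', rfl⟩ := ih hh' hL'
      exact ⟨b :: L', rfl⟩

lemma exists_interlacePairs_eq {N : ℕ} {L : List Bool} (hL : L.length = 2 * N) :
    ∃ ps : List (Bool × Bool), ps.length = N ∧ interlacePairs ps = L := by
  induction N generalizing L with
  | zero => exact ⟨[], rfl, (List.length_eq_zero_iff.1 hL).symm⟩
  | succ N ih =>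
    match L, hL with
    | a :: b :: L, hL =>
      obtain ⟨ps, hps, rfl⟩ := ih (L := L) (by simp only [List.length_cons] at hL; omega)
      exact ⟨(a, !b) :: ps, by simp [hps], by simp⟩

lemma interlacePairs_injective : Function.Injective interlacePairs := by
  intro ps qs h
  induction ps generalizing qs with
  | nil => cases qs with
    | nil => rfl
    | cons q qs => simp at h
  | cons p ps ih => cases qs with
    | nil => simp at h
    | cons q qs =>
      simp only [interlacePairs_cons, List.cons.injEq, Bool.not_inj_iff] at h
      rw [ih h.2.2, Prod.ext h.1 h.2.1]

lemma isDyckFrom_interlacePairs_iff (d : ℕ) (ps : List (Bool × Bool)) :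
    IsDyckFrom (2 * d + 1) (interlacePairs ps ++ [false]) ↔
      (∀ t, (ps.take t).countP Prod.snd ≤ d + (ps.take t).countP Prod.fst) ∧
        ps.countP Prod.snd = d + ps.countP Prod.fst := by
  induction ps generalizing d with
  | nil => simp [IsDyckFrom]; omega
  | cons p ps ih =>
    have key : ∀ P : ℕ → Prop, (∀ t, P t) ↔ P 0 ∧ ∀ t, P (t + 1) := fun P =>
      ⟨fun h => ⟨h 0, fun t => h _⟩, fun h t => by cases t; exacts [h.1, h.2 _]⟩
    rw [key]
    obtain ⟨r, g⟩ := p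
    cases r <;> cases g
    · simpa [IsDyckFrom, List.take_succ_cons] using ih d
    · rcases d with _ | d
      · simp only [interlacePairs_cons, List.cons_append, IsDyckFrom, List.take_succ_cons,
          List.countP_cons]
        simp only [Bool.not_true, IsDyckFrom]
        constructor
        · rintro ⟨-, h, -⟩
          simp at h
        · rintro ⟨⟨-, h⟩, -⟩
          simpa using h 0
      · have := ih d
        simp only [interlacePairs_cons, List.cons_append, IsDyckFrom, List.take_succ_cons,
          List.countP_cons, Bool.not_true]
        rw [show 2 * (d + 1) + 1 - 1 - 1 = 2 * d + 1 by omega, this]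
        simp
        grind
    · have := ih (d + 1)
      simp only [interlacePairs_cons, List.cons_append, IsDyckFrom, List.take_succ_cons,
        List.countP_cons, Bool.not_false]
      rw [show 2 * d + 1 + 1 + 1 = 2 * (d + 1) + 1 by omega, this]
      simp
      grind
    · have := ih d
      simp only [interlacePairs_cons, List.cons_append, IsDyckFrom, List.take_succ_cons,
        List.countP_cons, Bool.not_true]
      rw [show 2 * d + 1 + 1 - 1 = 2 * d + 1 by omega, this]
      simp
      grind

lemma countP_odd_areaWordAux {d : ℕ} {ps : List (Bool × Bool)}
    (h : IsDyckFrom (2 * d + 1) (interlacePairs ps ++ [false])) :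
    (areaWordAux (2 * d + 1) (interlacePairs ps ++ [false])).countP (fun c => c % 2 = 1) =
      ps.countP Prod.fst := by
  induction ps generalizing d with
  | nil => rfl
  | cons p ps ih =>
    obtain ⟨r, g⟩ := p
    cases r <;> cases g <;>
      simp only [interlacePairs_cons, List.cons_append, IsDyckFrom, Bool.not_true,
        Bool.not_false, areaWordAux, List.countP_cons] at h ⊢
    · rw [show 2 * d + 1 - 1 + 1 = 2 * d + 1 by omega] at h ⊢
      simp [ih h.2]
    · obtain ⟨-, hd, h⟩ := h
      obtain ⟨d, rfl⟩ : ∃ e, d = e + 1 := ⟨d - 1, by omega⟩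
      rw [show 2 * (d + 1) + 1 - 1 - 1 = 2 * d + 1 by omega] at h ⊢
      simp [ih h]
    · rw [show 2 * d + 1 + 1 + 1 = 2 * (d + 1) + 1 by omega] at h ⊢
      simp only [ih h]
      simp
      omega
    · rw [show 2 * d + 1 + 1 - 1 = 2 * d + 1 by omega] at h ⊢
      simp only [ih h.2]
      simp

lemma card_filter_lt_eq_countP_take {α : Type*} {N : ℕ} (f : Fin N → α) (p : α → Bool) (t : ℕ) :
    (univ.filter fun j : Fin N => (j : ℕ) < t ∧ p (f j) = true).card =
      ((List.ofFn f).take t).countP p := by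
  induction N generalizing t with
  | zero => simp
  | succ N ih =>
    cases t with
    | zero => simp
    | succ t =>
      rw [card_filter, Fin.sum_univ_succ, List.ofFn_succ, List.take_succ_cons,
        List.countP_cons, ← ih (fun i => f i.succ) t, card_filter, add_comm]
      simp

lemma card_filter_eq_countP {α : Type*} {N : ℕ} (f : Fin N → α) (p : α → Bool) :
    (univ.filter fun j : Fin N => p (f j) = true).card = (List.ofFn f).countP p := by
  have := card_filter_lt_eq_countP_take f p N
  rw [List.take_of_length_le (by simp)] at this
  simpa using this

/-- The pairs of steps of the red and green paths. -/
def RedPoly.pairs {m n : ℕ} (P : RedPoly m n) : List (Bool × Bool) :=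
  List.ofFn fun i => (P.red i, P.green i)

lemma interlaced_eq {m n : ℕ} (P : RedPoly m n) :
    interlaced P = true :: (interlacePairs P.pairs ++ [false]) := by
  simp [interlaced, interlacePairs, RedPoly.pairs, List.map_ofFn, Function.comp_def]

lemma RedPoly.countP_fst_pairs {m n : ℕ} (P : RedPoly m n) : P.pairs.countP Prod.fst = n := by
  rw [pairs, ← card_filter_eq_countP]
  exact P.red_count

lemma RedPoly.countP_snd_pairs {m n : ℕ} (P : RedPoly m n) : P.pairs.countP Prod.snd = n := by
  rw [pairs, ← card_filter_eq_countP]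
  exact P.green_count

lemma RedPoly.isDyckFrom_pairs {m n : ℕ} (P : RedPoly m n) :
    IsDyckFrom 1 (interlacePairs P.pairs ++ [false]) := by
  refine (isDyckFrom_interlacePairs_iff 0 _).2
    ⟨fun t => ?_, by rw [P.countP_fst_pairs, P.countP_snd_pairs, zero_add]⟩
  rw [zero_add]
  rcases Nat.eq_zero_or_pos t with rfl | ht
  · simp
  rcases le_or_gt t (m + n) with h | h
  · rw [pairs, ← card_filter_lt_eq_countP_take, ← card_filter_lt_eq_countP_take]
    convert P.green_le_red ⟨t - 1, by omega⟩ using 5 <;>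
      · rw [Fin.le_def]
        dsimp only
        omega
  · rw [List.take_of_length_le (by simp [pairs]; omega), P.countP_fst_pairs,
      P.countP_snd_pairs]

lemma areaWord_eq_cons {m n : ℕ} (P : RedPoly m n) :
    areaWord P = 0 :: areaWordAux 1 (interlacePairs P.pairs ++ [false]) := by
  rw [areaWord, interlaced_eq, areaWordAux]

lemma areaWord_injective {m n : ℕ} :
    Function.Injective (areaWord : RedPoly m n → List ℕ) := by
  intro P Q h
  rw [areaWord_eq_cons, areaWord_eq_cons, List.cons.injEq] at h
  have h := congrArg (pathOfWord 1) h.2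
  rw [pathOfWord_areaWordAux P.isDyckFrom_pairs,
    pathOfWord_areaWordAux Q.isDyckFrom_pairs] at h
  have h := List.ofFn_injective (interlacePairs_injective (List.append_cancel_right h))
  have hr : P.red = Q.red := funext fun i => congrArg Prod.fst (congrFun h i)
  have hg : P.green = Q.green := funext fun i => congrArg Prod.snd (congrFun h i)
  cases P
  cases Q
  simp_all

lemma length_areaWord {m n : ℕ} (P : RedPoly m n) : (areaWord P).length = m + n + 1 := by
  have h := length_eq_of_isDyckFrom P.isDyckFrom_pairs
  rw [List.length_append, List.length_singleton] at h
  have h2 : (interlacePairs P.pairs).length = 2 * (m + n) := by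
    simp [interlacePairs, RedPoly.pairs, List.length_flatten, Function.comp_def, mul_comm]
  rw [areaWord_eq_cons, List.length_cons]
  omega

lemma exists_areaWord_eq {m n : ℕ} {v : List ℕ} (hv : IsAreaWordFrom 1 v)
    (hlen : v.length = m + n) (hodd : v.countP (fun c => c % 2 = 1) = n) :
    ∃ P : RedPoly m n, areaWord P = 0 :: v := by
  have hD := isDyckFrom_pathOfWord hv
  have hW := areaWordAux_pathOfWord hv
  have hl := length_eq_of_isDyckFrom hD
  rw [hW, hlen] at hl
  obtain ⟨L, hL⟩ := exists_eq_append_false_of_isDyckFrom hD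
    (fun h => by simp [h] at hl)
  rw [hL] at hD hW hl
  obtain ⟨ps, hps, rfl⟩ := exists_interlacePairs_eq (N := m + n) (L := L)
    (by simp at hl; omega)
  obtain ⟨hle, heq⟩ := (isDyckFrom_interlacePairs_iff 0 ps).1 hD
  have hfst := countP_odd_areaWordAux (d := 0) hD
  rw [mul_zero, zero_add, hW, hodd] at hfst
  rw [zero_add] at heq
  obtain ⟨f, rfl⟩ : ∃ f : Fin (m + n) → Bool × Bool, ps = List.ofFn f :=
    ⟨fun i => ps[(i : ℕ)], List.ext_getElem (by simp [hps]) fun i _ _ => by simp⟩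
  refine ⟨⟨fun i => (f i).1, fun i => (f i).2, ?_, ?_, fun i => ?_⟩, ?_⟩
  · rw [card_filter_eq_countP f Prod.fst, ← hfst]
  · rw [card_filter_eq_countP f Prod.snd, heq, ← hfst]
  · have := hle (i + 1)
    rw [← card_filter_lt_eq_countP_take, ← card_filter_lt_eq_countP_take, zero_add] at this
    simpa only [Nat.lt_succ_iff, Fin.val_fin_le] using this
  · rw [areaWord_eq_cons, ← hW]
    rfl

lemma isAreaWordFrom_ofFn {N h : ℕ} (f : Fin N → ℕ) :
    IsAreaWordFrom h (List.ofFn f) ↔ (∀ i : Fin N, (i : ℕ) = 0 → f i ≤ h) ∧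
      ∀ i j : Fin N, (i : ℕ) + 1 = j → f j ≤ f i + 1 := by
  induction N generalizing h with
  | zero => simp [IsAreaWordFrom]
  | succ N ih =>
    rw [List.ofFn_succ, IsAreaWordFrom, ih]
    constructor
    · rintro ⟨h0, h1, h2⟩
      refine ⟨fun i hi => ?_, fun i j hij => ?_⟩
      · obtain rfl : i = 0 := Fin.ext hi
        exact h0
      · obtain ⟨j, rfl⟩ := Fin.exists_succ_eq.2 (show j ≠ 0 by rintro rfl; simp at hij)
        cases i using Fin.cases with
        | zero => exact h1 j (by simpa using hij.symm)
        | succ i => exact h2 i j (by simpa using hij)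
    · rintro ⟨h1, h2⟩
      exact ⟨h1 0 rfl, fun i hi => h2 0 i.succ (by simp [hi]),
        fun i j hij => h2 _ _ (by simpa using hij)⟩

/-- The letter obtained from an area word entry by putting a bar when its label is `1`. -/
def TwoCarsPF.letter {N : ℕ} (F : TwoCarsPF N) (i : Fin N) : ℕ :=
  2 * F.a i + if F.l i = 1 then 1 else 0

lemma TwoCarsPF.l_eq {N : ℕ} (F : TwoCarsPF N) (i : Fin N) : F.l i = 1 ∨ F.l i = 2 := by
  have := F.l_one_le i
  have := F.l_le_two i
  omega

lemma TwoCarsPF.letter_div_two {N : ℕ} (F : TwoCarsPF N) (i : Fin N) :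
    F.letter i / 2 = F.a i := by
  rw [letter]
  split_ifs <;> omega

lemma TwoCarsPF.letter_mod_two {N : ℕ} (F : TwoCarsPF N) (i : Fin N) :
    F.letter i % 2 = 1 ↔ F.l i = 1 := by
  rw [letter]
  split_ifs <;> omega

lemma TwoCarsPF.letter_injective {N : ℕ} :
    Function.Injective (TwoCarsPF.letter : TwoCarsPF N → Fin N → ℕ) := by
  intro F G h
  have ha : F.a = G.a := funext fun i => by rw [← F.letter_div_two, h, G.letter_div_two]
  have hl : F.l = G.l := funext fun i => by
    have h1 := F.letter_mod_two i
    rw [h, G.letter_mod_two] at h1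
    have := F.l_eq i
    have := G.l_eq i
    omega
  cases F
  cases G
  simp_all

lemma TwoCarsPF.isAreaWordFrom_letter {N : ℕ} (F : TwoCarsPF N) :
    IsAreaWordFrom 1 (List.ofFn F.letter) := by
  refine (isAreaWordFrom_ofFn _).2 ⟨fun i hi => ?_, fun i j hij => ?_⟩
  · rw [letter, F.a_first i hi]
    split_ifs <;> omega
  · have h1 := F.a_step i j hij
    have h2 := F.col_incr i j hij
    have := F.l_eq i
    have := F.l_eq j
    rw [letter, letter]
    split_ifs <;> omega

lemma TwoCarsPF.exists_letter_eq {N : ℕ} {c : Fin N → ℕ}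
    (hc : IsAreaWordFrom 1 (List.ofFn c)) : ∃ F : TwoCarsPF N, F.letter = c := by
  obtain ⟨h0, h1⟩ := (isAreaWordFrom_ofFn c).1 hc
  refine ⟨⟨fun i => c i / 2, fun i => if c i % 2 = 1 then 1 else 2, fun i hi => ?_,
    fun i j hij => ?_, fun i j hij => ?_, fun i => ?_, fun i => ?_⟩, funext fun i => ?_⟩
  · have := h0 i hi
    omega
  · have := h1 i j hij
    omega
  · have := h1 i j hij
    split_ifs <;> omega
  · split_ifs <;> omega
  · split_ifs <;> omega
  · simp only [letter]
    split_ifs <;> omega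

lemma TwoCarsPF.countP_odd_letter {N : ℕ} (F : TwoCarsPF N) :
    (List.ofFn F.letter).countP (fun c => c % 2 = 1) =
      (univ.filter fun i => F.l i = 1).card := by
  rw [← card_filter_eq_countP]
  simp only [decide_eq_true_eq, F.letter_mod_two]

lemma TwoCarsPF.card_filter_l_add {N : ℕ} (F : TwoCarsPF N) :
    (univ.filter fun i => F.l i = 1).card + (univ.filter fun i => F.l i = 2).card = N := by
  have h : (univ.filter fun i => F.l i = 2) = univ.filter fun i => ¬ F.l i = 1 :=
    filter_congr fun i _ => by
      have := F.l_eq i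
      omega
  rw [h, card_filter_add_card_filter_not, card_univ, Fintype.card_fin]

lemma getD_cons_ofFn {α : Type*} {N : ℕ} (x d : α) (f : Fin N → α) (i : Fin N) :
    (x :: List.ofFn f).getD (i + 1) d = f i := by
  simp

lemma TwoCarsPF.isPFRise_iff {N : ℕ} (F : TwoCarsPF N) (i : Fin N) :
    IsPFRise F i ↔ IsRise (0 :: List.ofFn F.letter) (i + 1) := by
  rw [IsRise, getD_cons_ofFn]
  constructor
  · rintro ⟨j, hj, h⟩
    rw [← hj, Nat.add_sub_cancel, getD_cons_ofFn]
    have h2 := F.col_incr j i hj h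
    have := F.l_eq i
    have := F.l_eq j
    refine ⟨by omega, by simp; omega, (F.letter_mod_two j).2 (by omega), ?_⟩
    rw [letter, letter]
    split_ifs <;> omega
  · rintro ⟨-, -, h1, h2⟩
    rw [Nat.add_sub_cancel] at h1 h2
    rcases i with ⟨_ | i, hi⟩
    · simp at h1
    · have hg := getD_cons_ofFn 0 0 F.letter ⟨i, by omega⟩
      rw [hg] at h1 h2
      refine ⟨⟨i, by omega⟩, rfl, ?_⟩
      rw [← F.letter_div_two, ← F.letter_div_two, h2]
      omega

lemma dinvStat_eq_pfDinv {m n : ℕ} {P : RedPoly m n} {F : TwoCarsPF (m + n)}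
    (h : areaWord P = 0 :: List.ofFn F.letter) : dinvStat P = pfDinv F := by
  symm
  rw [dinvStat, pfDinv, h, List.length_cons, List.length_ofFn]
  refine card_bij (fun p _ => ((p.1 : ℕ) + 1, (p.2 : ℕ) + 1)) ?_ ?_ ?_
  · rintro ⟨i, j⟩ hij
    simp only [mem_filter, mem_univ, true_and, mem_product, mem_range, getD_cons_ofFn] at hij ⊢
    obtain ⟨hlt, hij⟩ := hij
    have := F.l_eq i
    have := F.l_eq j
    refine ⟨⟨by omega, by omega⟩, by omega, ?_⟩
    rw [TwoCarsPF.letter, TwoCarsPF.letter]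
    split_ifs <;> omega
  · rintro ⟨i, j⟩ - ⟨i', j'⟩ - h
    simpa [Fin.ext_iff] using h
  · rintro ⟨i, j⟩ hij
    simp only [mem_filter, mem_product, mem_range] at hij
    obtain ⟨⟨hi, hj⟩, hlt, hij⟩ := hij
    rcases i with _ | i
    · simp at hij
    rcases j with _ | j
    · omega
    have hi' := getD_cons_ofFn 0 0 F.letter ⟨i, by omega⟩
    have hj' := getD_cons_ofFn 0 0 F.letter ⟨j, by omega⟩
    rw [hi', hj'] at hij
    refine ⟨(⟨i, by omega⟩, ⟨j, by omega⟩), ?_, rfl⟩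
    simp only [mem_filter, mem_univ, true_and, Fin.mk_lt_mk]
    refine ⟨by omega, ?_⟩
    have := F.l_eq ⟨i, by omega⟩
    have := F.l_eq ⟨j, by omega⟩
    rw [TwoCarsPF.letter, TwoCarsPF.letter] at hij
    split_ifs at hij <;> omega

lemma uArea_eq_pfUArea {m n k : ℕ} {Q : RiseDecorated m n k} {F : DecTwoCarsPF m n k}
    (h : areaWord Q.poly = 0 :: List.ofFn F.pf.letter)
    (hm : Q.marks = F.marks.image fun i : Fin (m + n) => (i : ℕ) + 1) :
    uArea Q = pfUArea F := by
  rw [uArea, pfUArea, h, hm, List.length_cons, List.length_ofFn, sdiff_eq_filter,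
    sdiff_eq_filter, sum_filter, sum_filter, sum_range_succ', sum_range]
  simp only [getD_cons_ofFn, F.pf.letter_div_two]
  simp [← Fin.ext_iff]

theorem exists_equiv_areaWord_eq (m n k : ℕ) :
    ∃ φ : DecTwoCarsPF m n k ≃ RiseDecorated m n k, ∀ F : DecTwoCarsPF m n k,
      areaWord (φ F).poly = 0 :: List.ofFn F.pf.letter ∧
      (φ F).marks = F.marks.image (fun i : Fin (m + n) => (i : ℕ) + 1) := by
  have hex (F : DecTwoCarsPF m n k) : ∃ Q : RiseDecorated m n k,
      areaWord Q.poly = 0 :: List.ofFn F.pf.letter ∧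
      Q.marks = F.marks.image (fun i : Fin (m + n) => (i : ℕ) + 1) := by
    obtain ⟨P, hP⟩ := exists_areaWord_eq (m := m) (n := n) F.pf.isAreaWordFrom_letter
      (by simp) (by rw [F.pf.countP_odd_letter, F.ones_count])
    refine ⟨⟨P, F.marks.image (fun i : Fin (m + n) => (i : ℕ) + 1), ?_, fun d hd => ?_⟩, hP, rfl⟩
    · rw [card_image_of_injective _ fun i j hij => by simpa [Fin.ext_iff] using hij,
        F.marks_card]
    · obtain ⟨i, hi, rfl⟩ := mem_image.1 hd
      rw [hP, ← F.pf.isPFRise_iff]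
      exact F.marks_rise i hi
  choose φ hφ hmarks using hex
  refine ⟨Equiv.ofBijective φ ⟨fun F G h => ?_, fun Q => ?_⟩, fun F => ⟨hφ F, hmarks F⟩⟩
  · have h1 := hφ F
    have h2 := hmarks F
    rw [h, hφ G, List.cons.injEq] at h1
    rw [h, hmarks G] at h2
    have hpf := TwoCarsPF.letter_injective (List.ofFn_injective h1.2)
    have hm := image_injective (fun i j hij => by simpa [Fin.ext_iff] using hij) h2
    cases F
    cases G
    simp_all
  · obtain ⟨c, hc⟩ : ∃ c : Fin (m + n) → ℕ, areaWord Q.poly = 0 :: List.ofFn c := by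
      have hl := length_areaWord Q.poly
      rw [areaWord_eq_cons, List.length_cons, add_left_inj] at hl
      refine ⟨fun i => (areaWordAux 1 (interlacePairs Q.poly.pairs ++ [false]))[(i : ℕ)], ?_⟩
      rw [areaWord_eq_cons, List.cons.injEq]
      refine ⟨rfl, List.ext_getElem (by simp [hl]) fun i _ _ => by simp⟩
    have hc' := areaWord_eq_cons Q.poly
    rw [hc, List.cons.injEq] at hc'
    obtain ⟨F, rfl⟩ := TwoCarsPF.exists_letter_eq (c := c)
      (hc'.2 ▸ isAreaWordFrom_areaWordAux _ _)
    have hones : (univ.filter fun i => F.l i = 1).card = n := by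
      have := countP_odd_areaWordAux (d := 0) Q.poly.isDyckFrom_pairs
      rwa [mul_zero, zero_add, ← hc'.2, F.countP_odd_letter, Q.poly.countP_fst_pairs] at this
    have himage : (univ.filter fun i : Fin (m + n) => (i : ℕ) + 1 ∈ Q.marks).image
        (fun i : Fin (m + n) => (i : ℕ) + 1) = Q.marks := by
      ext d
      simp only [mem_image, mem_filter, mem_univ, true_and]
      refine ⟨fun ⟨i, hi, h⟩ => h ▸ hi, fun hd => ?_⟩
      obtain ⟨h1, h2, -⟩ := Q.marks_rise d hd
      rw [length_areaWord] at h2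
      have h3 : d - 1 + 1 = d := by omega
      exact ⟨⟨d - 1, by omega⟩, by rwa [h3], h3⟩
    let G : DecTwoCarsPF m n k :=
      { pf := F
        ones_count := hones
        twos_count := by
          have := F.card_filter_l_add
          omega
        marks := univ.filter fun i : Fin (m + n) => (i : ℕ) + 1 ∈ Q.marks
        marks_card := by
          have := (congrArg card himage).trans Q.marks_card
          rwa [card_image_of_injective _ fun i j hij => by simpa [Fin.ext_iff] using hij] at this
        marks_rise := fun i hi => by
          rw [F.isPFRise_iff, ← hc]
          exact Q.marks_rise _ (mem_filter.1 hi).2 }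
    refine ⟨G, ?_⟩
    have h1 : (φ G).poly = Q.poly := areaWord_injective ((hφ G).trans hc.symm)
    have h2 : (φ G).marks = Q.marks := (hmarks G).trans himage
    revert h1 h2
    generalize φ G = R
    intro h1 h2
    cases R
    cases Q
    simp_all

theorem stmt7 (m n k : ℕ) (hm : 1 ≤ m) (hn : 1 ≤ n) :
    ∃ φ : DecTwoCarsPF m n k ≃ RiseDecorated m n k,
      ∀ F : DecTwoCarsPF m n k,
        dinvStat (φ F).poly = pfDinv F.pf ∧
        uArea (φ F) = pfUArea F ∧
        areaWord (φ F).poly =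
          0 :: List.ofFn (fun i : Fin (m + n) =>
            2 * F.pf.a i + if F.pf.l i = 1 then 1 else 0) ∧
        (φ F).marks = F.marks.image (fun i : Fin (m + n) => (i : ℕ) + 1) := by
  obtain ⟨φ, hφ⟩ := exists_equiv_areaWord_eq m n k
  exact ⟨φ, fun F => ⟨dinvStat_eq_pfDinv (hφ F).1, uArea_eq_pfUArea (hφ F).1 (hφ F).2, hφ F⟩⟩
end
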